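/- Let G = [3^k, ∞^l] (the case m = 0), with k, l ≥ 0 and n = k + l + 1. Then for every odd prime p, the group G^p = [3^k, ∞^l]^p is a string C-group, i.e., the intersection property ⟨r_i : i ∈ I⟩ ∩ ⟨r_i : i ∈ J⟩ = ⟨r_i : i ∈ I ∩ J⟩ holds for all I, J ⊆ {0,…,n−1}. -/

import Mathlib

/- Setup: the reduction mod an odd prime `p` of the `3`-infinity Coxeter group
`[3^k, ∞^l, 3^m]`, acting on `V = (ZMod p)^n` with `n = k + l + m + 1`. -/

namespace Statement9

/-- The Gram matrix of the basic system for `[3^k, ∞^l, 3^m]`, reduced mod `p`: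
diagonal entries `1`; the entry for the branch `{i−1, i}` is `−2⁻¹` if the branch is
labelled `3` (i.e. `1 ≤ i ≤ k` or `k+l+1 ≤ i ≤ n−1`) and `−1` if it is labelled `∞`
(i.e. `k+1 ≤ i ≤ k+l`); all other entries `0`. -/
def gram (p k l m : ℕ) : Matrix (Fin (k + l + m + 1)) (Fin (k + l + m + 1)) (ZMod p) :=
  fun i j =>
    if i = j then 1
    else if (j : ℕ) = (i : ℕ) + 1 then
      (if (j : ℕ) ≤ k ∨ k + l + 1 ≤ (j : ℕ) then -(2⁻¹ : ZMod p) else -1)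
    else if (i : ℕ) = (j : ℕ) + 1 then
      (if (i : ℕ) ≤ k ∨ k + l + 1 ≤ (i : ℕ) then -(2⁻¹ : ZMod p) else -1)
    else 0

/-- The corresponding symmetric bilinear form `x·y` on `V`. -/
def form (p k l m : ℕ) (x y : Fin (k + l + m + 1) → ZMod p) : ZMod p :=
  ∑ i, ∑ j, x i * gram p k l m i j * y j

/-- The general linear group of `V`. -/
abbrev GLV (p k l m : ℕ) := (Module.End (ZMod p) (Fin (k + l + m + 1) → ZMod p))ˣ

/-- `r i` is the generating reflection `r_i : x ↦ x − 2(x·b_i) b_i`. -/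
def ReflHyp (p k l m : ℕ) (r : Fin (k + l + m + 1) → GLV p k l m) : Prop :=
  ∀ i x, (r i).1 x =
    x - (2 * form p k l m x (Pi.single i 1)) •
      (Pi.single i 1 : Fin (k + l + m + 1) → ZMod p)

/-- The intersection property (string C-group condition). -/
def IsStringC (p k l m : ℕ) (r : Fin (k + l + m + 1) → GLV p k l m) : Prop :=
  ∀ I J : Set (Fin (k + l + m + 1)),
    Subgroup.closure (r '' I) ⊓ Subgroup.closure (r '' J) = Subgroup.closure (r '' (I ∩ J))

/-- `O₁(V)` (written `Ô₁(V)` when the form on `V` is degenerate): the subgroup of `O(V)`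
generated by all reflections `r_a : x ↦ x − 2((x·a)/(a·a)) a` with `a·a` a nonzero square. -/
def O1 (p k l m : ℕ) : Subgroup (GLV p k l m) :=
  Subgroup.closure {g | ∃ a : Fin (k + l + m + 1) → ZMod p,
    (∃ t : ZMod p, t ≠ 0 ∧ form p k l m a a = t ^ 2) ∧
    ∀ x, g.1 x = x - (2 * form p k l m x a * (form p k l m a a)⁻¹) • a}

section Reflections

variable {p : ℕ} [Fact p.Prime] {V : Type*} [AddCommGroup V] [Module (ZMod p) V]
  (B : LinearMap.BilinForm (ZMod p) V)

/-- The reflection in `a`, as an endomorphism; it is the identity when `a` is isotropic. -/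
def reflEnd (a : V) : Module.End (ZMod p) V :=
  LinearMap.id - (2 * (B a a)⁻¹) • (B.flip a).smulRight a

lemma reflEnd_apply (a x : V) :
    reflEnd B a x = x - (2 * B x a * (B a a)⁻¹) • a := by
  have h : B.flip a x = B x a := rfl
  simp only [reflEnd, LinearMap.sub_apply, LinearMap.id_apply, LinearMap.smul_apply,
    LinearMap.smulRight_apply, smul_smul, h]
  congr 2; ring

lemma reflEnd_mul_self (a : V) : reflEnd B a * reflEnd B a = 1 := by
  ext x
  simp only [Module.End.mul_apply, reflEnd_apply, Module.End.one_apply, map_sub, map_smul]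
  by_cases h : B a a = 0
  · simp [h]
  · match_scalars
    · rfl
    · field_simp
      ring

/-- The reflection in `a`, as a unit of the endomorphism ring. -/
def reflUnit (a : V) : (Module.End (ZMod p) V)ˣ :=
  ⟨reflEnd B a, reflEnd B a, reflEnd_mul_self B a, reflEnd_mul_self B a⟩

lemma reflUnit_apply (a x : V) :
    (reflUnit B a).1 x = x - (2 * B x a * (B a a)⁻¹) • a :=
  reflEnd_apply B a x

lemma reflUnit_mul_self (a : V) : reflUnit B a * reflUnit B a = 1 :=
  Units.ext (reflEnd_mul_self B a)

lemma reflUnit_inv (a : V) : (reflUnit B a)⁻¹ = reflUnit B a := rfl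

lemma units_ext {g h : (Module.End (ZMod p) V)ˣ} (H : ∀ x, g.1 x = h.1 x) : g = h :=
  Units.ext (LinearMap.ext H)

lemma reflUnit_smul {t : ZMod p} (ht : t ≠ 0) (a : V) :
    reflUnit B (t • a) = reflUnit B a := by
  refine units_ext fun x ↦ ?_
  simp only [reflUnit_apply, map_smul, LinearMap.smul_apply, smul_eq_mul]
  by_cases h : B a a = 0
  · simp [h]
  · match_scalars
    · rfl
    · field_simp

lemma reflUnit_isometry (hs : ∀ x y, B x y = B y x) (a x y : V) :
    B ((reflUnit B a).1 x) ((reflUnit B a).1 y) = B x y := by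
  simp only [reflUnit_apply, map_sub, map_smul, LinearMap.sub_apply, LinearMap.smul_apply,
    smul_eq_mul]
  by_cases h : B a a = 0
  · simp [h]
  · rw [hs a y]
    field_simp
    ring

/-- The group of isometries of `B`. -/
def isometries : Subgroup (Module.End (ZMod p) V)ˣ where
  carrier := {g | ∀ x y, B (g.1 x) (g.1 y) = B x y}
  one_mem' := fun _ _ ↦ rfl
  mul_mem' := fun {g h} hg hh x y ↦ by
    simpa [hh x y] using hg (h.1 x) (h.1 y)
  inv_mem' := fun {g} hg x y ↦ by
    have := hg ((g⁻¹).1 x) ((g⁻¹).1 y)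
    simpa [← Module.End.mul_apply] using this.symm

/-- The invertible endomorphisms acting trivially modulo `W`. -/
def trivialMod (W : Submodule (ZMod p) V) : Subgroup (Module.End (ZMod p) V)ˣ where
  carrier := {g | ∀ x, g.1 x - x ∈ W}
  one_mem' := fun _ ↦ by simp
  mul_mem' := fun {g h} hg hh x ↦ by
    simpa using W.add_mem (hg (h.1 x)) (hh x)
  inv_mem' := fun {g} hg x ↦ by
    have := W.neg_mem (hg ((g⁻¹).1 x))
    simpa [← Module.End.mul_apply] using this

lemma reflUnit_mem_trivialMod {W : Submodule (ZMod p) V} {a : V} (ha : a ∈ W) :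
    reflUnit B a ∈ trivialMod W := fun x ↦ by
  rw [reflUnit_apply, sub_sub_cancel_left]
  exact W.neg_mem (W.smul_mem _ ha)

lemma reflUnit_conj {g : (Module.End (ZMod p) V)ˣ}
    (hg : g ∈ isometries B) (a : V) :
    g * reflUnit B a * g⁻¹ = reflUnit B (g.1 a) := by
  refine units_ext fun x ↦ ?_
  have h1 : g.1 ((g⁻¹).1 x) = x := by simp [← Module.End.mul_apply]
  have h2 : B ((g⁻¹).1 x) a = B x (g.1 a) := by rw [← hg ((g⁻¹).1 x) a, h1]
  rw [Units.val_mul, Units.val_mul, Module.End.mul_apply, Module.End.mul_apply, reflUnit_apply,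
    reflUnit_apply, map_sub, map_smul, h1, h2, hg a a]

end Reflections

section CartanDieudonne

variable {p : ℕ} [Fact p.Prime] {V : Type*} [AddCommGroup V] [Module (ZMod p) V]
  (B : LinearMap.BilinForm (ZMod p) V)

/-- The group generated by the reflections in the anisotropic vectors of `W`. -/
def reflGroup (W : Submodule (ZMod p) V) : Subgroup (Module.End (ZMod p) V)ˣ :=
  Subgroup.closure {g | ∃ a ∈ W, B a a ≠ 0 ∧ g = reflUnit B a}

variable {B}

lemma reflUnit_mem_reflGroup {W : Submodule (ZMod p) V} {a : V} (ha : a ∈ W) (h : B a a ≠ 0) :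
    reflUnit B a ∈ reflGroup B W :=
  Subgroup.subset_closure ⟨a, ha, h, rfl⟩

lemma reflGroup_mono {W W' : Submodule (ZMod p) V} (h : W ≤ W') :
    reflGroup B W ≤ reflGroup B W' :=
  Subgroup.closure_mono fun _ ⟨a, ha, h1, h2⟩ ↦ ⟨a, h ha, h1, h2⟩

lemma reflGroup_le_isometries (hs : ∀ x y, B x y = B y x) (W : Submodule (ZMod p) V) :
    reflGroup B W ≤ isometries B := by
  rw [reflGroup, Subgroup.closure_le]
  rintro _ ⟨a, -, -, rfl⟩
  exact reflUnit_isometry B hs a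

lemma reflGroup_le_trivialMod (W : Submodule (ZMod p) V) : reflGroup B W ≤ trivialMod W := by
  rw [reflGroup, Subgroup.closure_le]
  rintro _ ⟨a, ha, -, rfl⟩
  exact reflUnit_mem_trivialMod B ha

lemma exists_reflGroup_apply_eq (hs : ∀ x y, B x y = B y x) (h2 : (2 : ZMod p) ≠ 0)
    {W : Submodule (ZMod p) V} {x b : V} (hx : x ∈ W) (hb : b ∈ W) (hbb : B b b ≠ 0)
    (hxb : B x x = B b b) : ∃ h ∈ reflGroup B W, h.1 x = b := by
  by_cases hm : B (x - b) (x - b) = 0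
  · have hp : B (x + b) (x + b) ≠ 0 := fun hp ↦ by
      have : B (x - b) (x - b) + B (x + b) (x + b) = 2 * 2 * B b b := by
        simp only [map_sub, map_add, LinearMap.sub_apply, LinearMap.add_apply, hxb]; ring
      rw [hm, hp, add_zero] at this
      exact mul_ne_zero (mul_ne_zero h2 h2) hbb this.symm
    refine ⟨reflUnit B b * reflUnit B (x + b), mul_mem (reflUnit_mem_reflGroup hb hbb)
      (reflUnit_mem_reflGroup (W.add_mem hx hb) hp), ?_⟩
    have e : B (x + b) (x + b) = 2 * B x (x + b) := by
      simp only [map_add, LinearMap.add_apply, hxb, hs b x]; ring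
    have e1 : (reflUnit B (x + b)).1 x = -b := by
      rw [reflUnit_apply, ← e, mul_inv_cancel₀ hp]; module
    rw [Units.val_mul, Module.End.mul_apply, e1, reflUnit_apply, map_neg, LinearMap.neg_apply,
      mul_neg, neg_mul, mul_assoc, mul_inv_cancel₀ hbb]
    module
  · refine ⟨reflUnit B (x - b), reflUnit_mem_reflGroup (W.sub_mem hx hb) hm, ?_⟩
    have e : B (x - b) (x - b) = 2 * B x (x - b) := by
      simp only [map_sub, LinearMap.sub_apply, hxb, hs b x]; ring
    rw [reflUnit_apply, ← e, mul_inv_cancel₀ hm]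
    module

lemma eq_one_of_isotropic (hs : ∀ x y, B x y = B y x) (h2 : (2 : ZMod p) ≠ 0)
    {W : Submodule (ZMod p) V} (hW : ∀ b ∈ W, B b b = 0)
    (hline : ∀ c ∈ W, ∀ d ∈ W, c ≠ 0 → ∃ t : ZMod p, d = t • c)
    (hrad : ∀ x ∈ W, (∀ y, B x y = 0) → x = 0)
    {g : (Module.End (ZMod p) V)ˣ} (hg : g ∈ isometries B) (hgW : g ∈ trivialMod W) : g = 1 := by
  have key : ∀ x, B x (g.1 x - x) = 0 := fun x ↦ by
    have e : B (g.1 x) (g.1 x) = B x x + 2 * B x (g.1 x - x) + B (g.1 x - x) (g.1 x - x) := by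
      simp only [map_sub, LinearMap.sub_apply, hs (g.1 x) x]; ring
    rw [hg x x, hW _ (hgW x), add_zero, left_eq_add] at e
    exact (mul_eq_zero.mp e).resolve_left h2
  refine units_ext fun x ↦ sub_eq_zero.mp ?_
  change g.1 x - x = 0
  by_contra hne
  refine hne (hrad _ (hgW x) fun y ↦ ?_)
  obtain ⟨t, ht⟩ := hline _ (hgW x) _ (hgW y) hne
  have h3 := key (x + y)
  have e : g.1 (x + y) - (x + y) = (g.1 x - x) + (g.1 y - y) := by rw [map_add]; abel
  rw [e, ht] at h3
  have h4 := key y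
  rw [ht] at h4
  simp only [map_add, map_smul, LinearMap.add_apply, smul_eq_mul] at h3 h4
  rw [key x] at h3
  rw [hs]
  linear_combination h3 - h4

/-- A Cartan–Dieudonné theorem for isometries acting trivially modulo a subspace `W` whose radical
is at most a line and meets the radical of the whole space trivially. -/
theorem mem_reflGroup [FiniteDimensional (ZMod p) V] (hs : ∀ x y, B x y = B y x)
    (h2 : (2 : ZMod p) ≠ 0) (W : Submodule (ZMod p) V)
    (hline : ∀ c ∈ W, ∀ d ∈ W, (∀ w ∈ W, B c w = 0) → (∀ w ∈ W, B d w = 0) → c ≠ 0 →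
      ∃ t : ZMod p, d = t • c)
    (hrad : ∀ x ∈ W, (∀ y, B x y = 0) → x = 0)
    (g : (Module.End (ZMod p) V)ˣ) (hg : g ∈ isometries B) (hgW : g ∈ trivialMod W) :
    g ∈ reflGroup B W := by
  induction hn : Module.finrank (ZMod p) W using Nat.strong_induction_on generalizing W g with
  | _ n ih =>
  by_cases hW : ∀ b ∈ W, B b b = 0
  · have hiso : ∀ c ∈ W, ∀ d ∈ W, B c d = 0 := fun c hc d hd ↦ by
      have := hW _ (W.add_mem hc hd)
      simp only [map_add, LinearMap.add_apply, hW c hc, hW d hd, hs d c, zero_add, add_zero,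
        ← two_mul] at this
      exact (mul_eq_zero.mp this).resolve_left h2
    rw [eq_one_of_isotropic hs h2 hW (fun c hc d hd ↦ hline c hc d hd (hiso c hc) (hiso d hd))
      hrad hg hgW]
    exact one_mem _
  · push Not at hW
    obtain ⟨b, hb, hbb⟩ := hW
    have hgb : g.1 b ∈ W := by simpa using W.add_mem (hgW b) hb
    obtain ⟨h, hh, hhb⟩ := exists_reflGroup_apply_eq hs h2 hgb hb hbb (hg b b)
    set W' : Submodule (ZMod p) V := W ⊓ LinearMap.ker (B.flip b) with hW'
    have memW' : ∀ x, x ∈ W' ↔ x ∈ W ∧ B x b = 0 := fun x ↦ by simp [hW']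
    have hlt : Module.finrank (ZMod p) W' < n := by
      rw [← hn]
      refine Submodule.finrank_lt_finrank_of_lt (lt_of_le_of_ne inf_le_left fun e ↦ hbb ?_)
      exact ((memW' b).1 (e ▸ hb)).2
    have radW : ∀ c ∈ W', (∀ w ∈ W', B c w = 0) → ∀ w ∈ W, B c w = 0 := by
      intro c hc hcW w hw
      have h3 := hcW (w - (B w b * (B b b)⁻¹) • b) ((memW' _).2 ⟨W.sub_mem hw (W.smul_mem _ hb), by
        simp [hbb]⟩)
      simpa [((memW' c).1 hc).2] using h3
    have hg' : h * g ∈ isometries B := mul_mem (reflGroup_le_isometries hs W hh) hg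
    have hgb' : (h * g).1 b = b := by simpa using hhb
    have hgW' : h * g ∈ trivialMod W := mul_mem (reflGroup_le_trivialMod W hh) hgW
    have := ih _ hlt W' (fun c hc d hd hc' hd' ↦ hline c ((memW' c).1 hc).1 d ((memW' d).1 hd).1
        (radW c hc hc') (radW d hd hd')) (fun x hx ↦ hrad x ((memW' x).1 hx).1) (h * g) hg'
        (fun x ↦ (memW' _).2 ⟨hgW' x, by
          have := hg' x b
          rw [hgb'] at this
          rw [map_sub, LinearMap.sub_apply, this, sub_self]⟩) rfl
    simpa using mul_mem (inv_mem hh) (reflGroup_mono (inf_le_left : W' ≤ W) this)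

end CartanDieudonne

section Sign

lemma even_card_of_involution {α : Type*} (S : Finset α) (τ : α → α) (hτS : ∀ x ∈ S, τ x ∈ S)
    (hτ : ∀ x ∈ S, τ (τ x) = x) (hne : ∀ x ∈ S, τ x ≠ x) : Even S.card := by
  have h : ∑ _x ∈ S, (1 : ZMod 2) = 0 :=
    Finset.sum_involution (fun x _ ↦ τ x) (fun _ _ ↦ by decide) (fun x hx _ ↦ hne x hx) hτS hτ
  rw [Finset.sum_const, nsmul_one] at h
  exact (ZMod.natCast_eq_zero_iff_even).1 h

lemma sign_eq_of_half {α : Type*} [Fintype α] [DecidableEq α] (σ : Equiv.Perm α) (hσ : σ ^ 2 = 1)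
    (P : α → Prop) [DecidablePred P] (hP : ∀ x, σ x ≠ x → (P (σ x) ↔ ¬ P x)) :
    Equiv.Perm.sign σ = (-1) ^ (Finset.univ.filter fun x ↦ σ x ≠ x ∧ P x).card := by
  have hσσ : ∀ x, σ (σ x) = x := fun x ↦ by
    rw [← Equiv.Perm.mul_apply, ← sq, hσ, Equiv.Perm.one_apply]
  have h1 : (Finset.univ.filter fun x ↦ σ x ≠ x ∧ P x).card =
      (Finset.univ.filter fun x ↦ σ x ≠ x ∧ ¬ P x).card := by
    refine Finset.card_bij (fun x _ ↦ σ x) ?_ (fun _ _ _ _ h ↦ σ.injective h) ?_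
    · intro x hx
      simp only [Finset.mem_filter, Finset.mem_univ, true_and] at hx ⊢
      refine ⟨fun h ↦ hx.1 (σ.injective h), fun h ↦ (hP x hx.1).1 h hx.2⟩
    · intro x hx
      simp only [Finset.mem_filter, Finset.mem_univ, true_and] at hx
      exact ⟨σ x, by simpa [hσσ, hx.1.symm] using (hP x hx.1).2 hx.2, hσσ x⟩
  have h2 : (Finset.univ.filter fun x ↦ σ x ≠ x).card =
      2 * (Finset.univ.filter fun x ↦ σ x ≠ x ∧ P x).card := by
    rw [two_mul]
    nth_rewrite 2 [h1]
    rw [← Finset.card_filter_add_card_filter_not (s := Finset.univ.filter fun x ↦ σ x ≠ x) P,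
      Finset.filter_filter, Finset.filter_filter]
  rw [Equiv.Perm.sign_of_pow_two_eq_one hσ, ← Fintype.card_compl_set]
  congr 1
  rw [← Nat.mul_div_cancel_left (Finset.card _) two_pos, ← h2, Fintype.card_subtype]
  rfl

variable {p : ℕ} [Fact p.Prime] {V : Type*} [AddCommGroup V] [Module (ZMod p) V]
  (B : LinearMap.BilinForm (ZMod p) V)

lemma isSquare_mul_of_not {a b : ZMod p} (hp : p ≠ 2) (ha : ¬ IsSquare a) (hb : ¬ IsSquare b) :
    IsSquare (a * b) := by
  have hc : ringChar (ZMod p) ≠ 2 := by rwa [ZMod.ringChar_zmod_n]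
  have ha0 : a ≠ 0 := fun h ↦ ha (h ▸ IsSquare.zero)
  have hb0 : b ≠ 0 := fun h ↦ hb (h ▸ IsSquare.zero)
  rw [← quadraticChar_one_iff_isSquare (mul_ne_zero ha0 hb0), map_mul,
    quadraticChar_neg_one_iff_not_isSquare.2 ha, quadraticChar_neg_one_iff_not_isSquare.2 hb]
  rfl

/-- The action of the isometry group on the vectors of norm `ν`. -/
def sphereHom (ν : ZMod p) : isometries B →* Equiv.Perm {x : V // B x x = ν} where
  toFun g :=
    { toFun := fun x ↦ ⟨g.1.1 x.1, (g.2 _ _).trans x.2⟩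
      invFun := fun x ↦ ⟨(g⁻¹).1.1 x.1, ((g⁻¹).2 _ _).trans x.2⟩
      left_inv := fun x ↦ Subtype.ext (by simp [← Module.End.mul_apply])
      right_inv := fun x ↦ Subtype.ext (by simp [← Module.End.mul_apply]) }
  map_one' := rfl
  map_mul' _ _ := rfl

/-- The sign of the action of an isometry on the vectors of norm `ν`. -/
noncomputable def sphereSign [Finite V] (ν : ZMod p) : isometries B →* ℤˣ :=
  letI : DecidableEq {x : V // B x x = ν} := Classical.decEq _
  letI : Fintype {x : V // B x x = ν} := Fintype.ofFinite _
  Equiv.Perm.sign.comp (sphereHom B ν)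

lemma two_mul_val_neg_lt (hp : p ≠ 2) {t : ZMod p} (ht : t ≠ 0) :
    2 * (-t).val < p ↔ ¬ 2 * t.val < p := by
  have h1 := ZMod.val_lt t
  have h2 := (Fact.out : p.Prime).eq_two_or_odd
  rw [ZMod.neg_val, if_neg ht]
  omega

lemma exists_sphereSign_reflUnit [Finite V] (hp : p ≠ 2) (hs : ∀ x y, B x y = B y x)
    (h2 : (2 : ZMod p) ≠ 0) (ν : ZMod p) (a : V)
    (ha : B a a ≠ 0) : ∃ S : Finset {x : V // B x x = ν},
      (∀ x, x ∈ S ↔ B x.1 a ≠ 0 ∧ 2 * (B x.1 a).val < p) ∧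
      sphereSign B ν ⟨reflUnit B a, reflUnit_isometry B hs a⟩ = (-1) ^ S.card := by
  let : DecidableEq {x : V // B x x = ν} := Classical.decEq _
  let : Fintype {x : V // B x x = ν} := Fintype.ofFinite _
  set σ := sphereHom B ν ⟨reflUnit B a, reflUnit_isometry B hs a⟩ with hσ
  have hσB : ∀ x, B (σ x).1 a = - B x.1 a := fun x ↦ by
    change B ((reflUnit B a).1 x.1) a = _
    rw [reflUnit_apply, map_sub, map_smul, LinearMap.sub_apply, LinearMap.smul_apply, smul_eq_mul]
    field_simp
    ring
  have hσx : ∀ x, σ x ≠ x ↔ B x.1 a ≠ 0 := fun x ↦ not_congr ⟨fun h ↦ by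
    have := hσB x
    rw [h] at this
    have h3 : 2 * B x.1 a = 0 := by linear_combination this
    exact (mul_eq_zero.mp h3).resolve_left h2, fun h ↦ Subtype.ext (by
    change (reflUnit B a).1 x.1 = _
    rw [reflUnit_apply, h]; simp)⟩
  have hsq : σ ^ 2 = 1 := by
    rw [hσ, ← map_pow, sq]
    exact (congrArg _ (Subtype.ext (reflUnit_mul_self B a))).trans (map_one _)
  refine ⟨Finset.univ.filter fun x ↦ σ x ≠ x ∧ 2 * (B x.1 a).val < p, fun x ↦ by
    simp [hσx], ?_⟩
  rw [← sign_eq_of_half σ hsq (fun x ↦ 2 * (B x.1 a).val < p) fun x hx ↦ by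
    rw [hσB]; exact two_mul_val_neg_lt hp ((hσx x).1 hx)]
  rfl

/-- Reflecting in the line through `a`, followed by `-1`, acts on the vectors of norm `ν`. -/
def negRefl (hs : ∀ x y, B x y = B y x) (ν : ZMod p) (a : V) (x : {x : V // B x x = ν}) :
    {x : V // B x x = ν} :=
  ⟨-(reflUnit B a).1 x.1, by
    simpa using (reflUnit_isometry B hs a x.1 x.1).trans x.2⟩

variable {B}

lemma negRefl_negRefl (hs : ∀ x y, B x y = B y x) (ν : ZMod p) (a : V)
    (x : {x : V // B x x = ν}) : negRefl B hs ν a (negRefl B hs ν a x) = x := by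
  refine Subtype.ext ?_
  change -(reflUnit B a).1 (-(reflUnit B a).1 x.1) = x.1
  rw [map_neg, neg_neg, ← Module.End.mul_apply, ← Units.val_mul, reflUnit_mul_self]
  rfl

lemma form_negRefl (hs : ∀ x y, B x y = B y x) (ν : ZMod p) {a : V} (ha : B a a ≠ 0)
    (x : {x : V // B x x = ν}) : B (negRefl B hs ν a x).1 a = B x.1 a := by
  change B (-(reflUnit B a).1 x.1) a = _
  rw [reflUnit_apply, map_neg, map_sub, map_smul, LinearMap.neg_apply, LinearMap.sub_apply,
    LinearMap.smul_apply, smul_eq_mul]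
  field_simp
  ring

lemma eq_smul_of_negRefl_eq (hs : ∀ x y, B x y = B y x) (h2 : (2 : ZMod p) ≠ 0) {ν : ZMod p}
    {a : V} (x : {x : V // B x x = ν})
    (h : negRefl B hs ν a x = x) : x.1 = (B x.1 a * (B a a)⁻¹) • a := by
  have h1 : -(reflUnit B a).1 x.1 = x.1 := congrArg Subtype.val h
  rw [reflUnit_apply] at h1
  have h3 : (2 : ZMod p) • x.1 = (2 : ZMod p) • ((B x.1 a * (B a a)⁻¹) • a) := by
    have : (2 : ZMod p) • x.1 = x.1 + x.1 := two_smul _ _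
    rw [this]
    nth_rewrite 1 [← h1]
    module
  exact smul_right_injective V h2 h3

lemma sphereSign_reflUnit_of_isSquare [Finite V] (hp : p ≠ 2) (hs : ∀ x y, B x y = B y x)
    (h2 : (2 : ZMod p) ≠ 0) {ν : ZMod p} (hν : ¬ IsSquare ν) {a : V} (ha : B a a ≠ 0)
    (hsq : IsSquare (B a a)) :
    sphereSign B ν ⟨reflUnit B a, reflUnit_isometry B hs a⟩ = 1 := by
  obtain ⟨S, hS, h⟩ := exists_sphereSign_reflUnit B hp hs h2 ν a ha
  rw [h]
  refine (even_card_of_involution S (negRefl B hs ν a) (fun x hx ↦ ?_)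
    (fun x _ ↦ negRefl_negRefl hs ν a x) fun x _ hx ↦ hν ?_).neg_one_pow
  · rw [hS, form_negRefl hs ν ha, ← hS]; exact hx
  · have h3 := eq_smul_of_negRefl_eq hs h2 x hx
    rw [← x.2]
    have h4 := congrArg (fun y ↦ B y y) h3
    simp only [map_smul, LinearMap.smul_apply, smul_eq_mul, ← mul_assoc] at h4
    rw [h4]
    simpa only [mul_assoc] using (IsSquare.mul_self (B x.1 a * (B a a)⁻¹)).mul hsq

lemma sphereSign_reflUnit_of_not_isSquare [Finite V] (hp : p ≠ 2) (hs : ∀ x y, B x y = B y x)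
    (h2 : (2 : ZMod p) ≠ 0) {ν : ZMod p} (hν : ¬ IsSquare ν) {a : V} (ha : ¬ IsSquare (B a a)) :
    sphereSign B ν ⟨reflUnit B a, reflUnit_isometry B hs a⟩ = -1 := by
  classical
  have ha0 : B a a ≠ 0 := fun h ↦ ha (h ▸ IsSquare.zero)
  obtain ⟨S, hS, h⟩ := exists_sphereSign_reflUnit B hp hs h2 ν a ha0
  obtain ⟨t, ht⟩ := isSquare_mul_of_not hp hν ha
  have hν0 : ν ≠ 0 := fun h ↦ hν (h ▸ IsSquare.zero)
  have ht0 : t ≠ 0 := by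
    rintro rfl
    exact mul_ne_zero hν0 ha0 (by simpa using ht)
  obtain ⟨t, ht, ht0, htp⟩ : ∃ t : ZMod p, ν * B a a = t * t ∧ t ≠ 0 ∧ 2 * t.val < p := by
    by_cases htp : 2 * t.val < p
    · exact ⟨t, ht, ht0, htp⟩
    · exact ⟨-t, by rw [ht]; ring, neg_ne_zero.2 ht0, (two_mul_val_neg_lt hp ht0).2 htp⟩
  let x₀ : {x : V // B x x = ν} := ⟨(t * (B a a)⁻¹) • a, by
    simp only [map_smul, LinearMap.smul_apply, smul_eq_mul]
    field_simp
    linear_combination -ht⟩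
  have hx₀ : B x₀.1 a = t := by
    simp only [x₀, map_smul, LinearMap.smul_apply, smul_eq_mul]
    field_simp
  have hx₀S : x₀ ∈ S := by rw [hS, hx₀]; exact ⟨ht0, htp⟩
  have hfix : ∀ x ∈ S, negRefl B hs ν a x = x → x = x₀ := by
    intro x hx hxx
    have h3 := eq_smul_of_negRefl_eq hs h2 x hxx
    have h4 : B x.1 a * B x.1 a = t * t := by
      have h4 := congrArg (fun y ↦ B y y) h3
      simp only [map_smul, LinearMap.smul_apply, smul_eq_mul, x.2] at h4
      rw [← ht]
      calc B x.1 a * B x.1 a = B x.1 a * (B a a)⁻¹ * (B x.1 a * (B a a)⁻¹ * B a a) * B a a := by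
            field_simp
        _ = ν * B a a := by rw [← h4]
    rcases mul_self_eq_mul_self_iff.1 h4 with h5 | h5
    · exact Subtype.ext (by rw [h3, h5])
    · have h6 := ((hS x).1 hx).2
      rw [h5, two_mul_val_neg_lt hp ht0] at h6
      exact absurd htp h6
  have hx₀fix : negRefl B hs ν a x₀ = x₀ := by
    refine Subtype.ext ?_
    change -(reflUnit B a).1 ((t * (B a a)⁻¹) • a) = (t * (B a a)⁻¹) • a
    rw [map_smul, reflUnit_apply, mul_assoc, mul_inv_cancel₀ ha0]
    module
  have hmaps : ∀ x ∈ S, negRefl B hs ν a x ∈ S := fun x hx ↦ by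
    rw [hS, form_negRefl hs ν ha0, ← hS]; exact hx
  have heven : Even (S.erase x₀).card := by
    refine even_card_of_involution _ (negRefl B hs ν a) (fun x hx ↦ ?_)
      (fun x _ ↦ negRefl_negRefl hs ν a x) fun x hx hxx ↦ ?_
    · rw [Finset.mem_erase] at hx ⊢
      refine ⟨fun e ↦ hx.1 ?_, hmaps x hx.2⟩
      rw [← negRefl_negRefl hs ν a x, e, hx₀fix]
    · rw [Finset.mem_erase] at hx
      exact hx.1 (hfix x hx.2 hxx)
  rw [h, ← Finset.card_erase_add_one hx₀S]
  exact heven.add_one.neg_one_pow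

end Sign


section Siegel

variable {p : ℕ} [Fact p.Prime] {V : Type*} [AddCommGroup V] [Module (ZMod p) V]
  {B : LinearMap.BilinForm (ZMod p) V}

/-- The Siegel transformation attached to an isotropic vector `c` and a vector `u` orthogonal
to it. -/
def siegel (B : LinearMap.BilinForm (ZMod p) V) (c u x : V) : V :=
  x + B x c • u - B x u • c - (2⁻¹ * B u u * B x c) • c

lemma siegel_add (h2 : (2 : ZMod p) ≠ 0) (hs : ∀ x y, B x y = B y x) {c u u' : V} (hc : B c c = 0)
    (hu : B u c = 0) (hu' : B u' c = 0) (x : V) :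
    siegel B c (u + u') x = siegel B c u (siegel B c u' x) := by
  have h1 := hs u' u
  have h3 := (hs c u).trans hu
  simp only [siegel, map_add, map_sub, map_smul, LinearMap.add_apply, LinearMap.sub_apply,
    LinearMap.smul_apply, smul_eq_mul, hc, hu', h3, h1]
  match_scalars <;> field_simp <;> ring

lemma siegel_norm (h2 : (2 : ZMod p) ≠ 0) (hs : ∀ x y, B x y = B y x) {c u : V} (hc : B c c = 0)
    (hu : B u c = 0) (x : V) : B (siegel B c u x) (siegel B c u x) = B x x := by
  have h1 := hs u x
  have h3 := (hs c u).trans hu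
  have h4 := hs c x
  simp only [siegel, map_add, map_sub, map_smul, LinearMap.add_apply, LinearMap.sub_apply,
    LinearMap.smul_apply, smul_eq_mul, hc, hu, h3, h1, h4]
  field_simp
  ring

/-- A set of vectors of norm `1` closed under the reflections in its elements. -/
structure IsRootSet (B : LinearMap.BilinForm (ZMod p) V) (Φ : Set V) : Prop where
  norm : ∀ x ∈ Φ, B x x = 1
  refl : ∀ x ∈ Φ, ∀ y ∈ Φ, y - (2 * B y x) • x ∈ Φ

lemma IsRootSet.neg {Φ : Set V} (hΦ : IsRootSet B Φ) {x : V} (hx : x ∈ Φ) : -x ∈ Φ := by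
  have := hΦ.refl x hx x hx
  rw [hΦ.norm x hx] at this
  convert this using 1
  module

/-- The vectors orthogonal to `c` whose Siegel transformations preserve `Φ`. -/
def siegelModule (h2 : (2 : ZMod p) ≠ 0) (hs : ∀ x y, B x y = B y x) {c : V} (hc : B c c = 0)
    (Φ : Set V) : Submodule (ZMod p) V where
  carrier := {u | B u c = 0 ∧ ∀ t : ZMod p, ∀ x ∈ Φ, siegel B c (t • u) x ∈ Φ}
  zero_mem' := ⟨by simp, fun t x hx ↦ by simpa [siegel] using hx⟩
  add_mem' := fun {u v} hu hv ↦ ⟨by simp [hu.1, hv.1], fun t x hx ↦ by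
    rw [smul_add, siegel_add h2 hs hc (by simp [hu.1]) (by simp [hv.1])]
    exact hu.2 t _ (hv.2 t x hx)⟩
  smul_mem' := fun s u hu ↦ ⟨by simp [hu.1], fun t x hx ↦ by
    rw [smul_smul]; exact hu.2 _ x hx⟩

variable {h2 : (2 : ZMod p) ≠ 0} {hs : ∀ x y, B x y = B y x} {c : V} {hc : B c c = 0} {Φ : Set V}

lemma self_mem_siegelModule : c ∈ siegelModule h2 hs hc Φ :=
  ⟨hc, fun t x hx ↦ by
    have : siegel B c (t • c) x = x := by
      simp only [siegel, map_smul, LinearMap.smul_apply, hc, smul_eq_mul]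
      module
    rwa [this]⟩

lemma mem_siegelModule_of_add_smul_mem (hΦ : IsRootSet B Φ) {u : V} (hu : u ∈ Φ) (huc : B u c = 0)
    {s : ZMod p} (hs0 : s ≠ 0) (hus : u + s • c ∈ Φ) : u ∈ siegelModule h2 hs hc Φ := by
  have hcu : B c u = 0 := (hs c u).trans huc
  have h1 : ∀ x ∈ Φ, siegel B c ((2 * s) • u) x ∈ Φ := fun x hx ↦ by
    have h3 := hΦ.refl u hu _ (hΦ.refl _ hus x hx)
    convert h3 using 1
    simp only [siegel, map_add, map_sub, map_smul, LinearMap.add_apply, LinearMap.sub_apply,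
      LinearMap.smul_apply, smul_eq_mul, hcu, hΦ.norm u hu]
    match_scalars
    · ring
    · ring
    · field_simp
      ring
  have h3 : ∀ m : ℕ, ∀ x ∈ Φ, siegel B c ((m * (2 * s)) • u) x ∈ Φ := fun m ↦ by
    induction m with
    | zero => intro x hx; simpa [siegel] using hx
    | succ m ih =>
      intro x hx
      have e : (((m + 1 : ℕ) : ZMod p) * (2 * s)) • u = (m * (2 * s)) • u + (2 * s) • u := by
        push_cast; module
      rw [e, siegel_add h2 hs hc (by simp [huc]) (by simp [huc])]
      exact ih _ (h1 x hx)
  refine ⟨huc, fun t x hx ↦ ?_⟩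
  have := h3 (t * (2 * s)⁻¹).val x hx
  rwa [ZMod.natCast_val, ZMod.cast_id', id, inv_mul_cancel_right₀ (mul_ne_zero h2 hs0)] at this

lemma add_smul_mem_of_mem_siegelModule {u : V} (hu : u ∈ Φ) (huN : u ∈ siegelModule h2 hs hc Φ)
    (hn : B u u = 1) (t : ZMod p) : u + t • c ∈ Φ := by
  convert huN.2 (-t) u hu using 1
  simp only [siegel, map_smul, LinearMap.smul_apply, smul_eq_mul, huN.1, hn]
  module

lemma refl_mem_siegelModule (hΦ : IsRootSet B Φ) {x u : V} (hx : x ∈ Φ) (hxc : B x c = 0)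
    (hu : u ∈ siegelModule h2 hs hc Φ) : u - (2 * B u x) • x ∈ siegelModule h2 hs hc Φ := by
  have hcx : B c x = 0 := (hs c x).trans hxc
  have hxx := hΦ.norm x hx
  refine ⟨by simp [hxc, hu.1], fun t y hy ↦ ?_⟩
  convert hΦ.refl x hx _ (hu.2 t _ (hΦ.refl x hx y hy)) using 1
  have h3 := hs x u
  simp only [siegel, map_add, map_sub, map_smul, LinearMap.add_apply, LinearMap.sub_apply,
    LinearMap.smul_apply, smul_eq_mul, hcx, hxc, hxx, h3]
  match_scalars
  · ring
  · ring
  · ring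
  · field_simp
    ring

lemma mem_of_mul_ne_zero (hΦ : IsRootSet B Φ) {W : Submodule (ZMod p) V} {a b : V}
    (haW : a ∈ W) (hbW : b ∈ W) (ha : a ∈ Φ) (hb : b ∈ Φ) (haN : a ∈ siegelModule h2 hs hc Φ)
    (hbc : B b c ≠ 0) (hcW : c ∈ W)
    (hW : ∀ u ∈ W, B u c = 0 → u ∈ siegelModule h2 hs hc Φ) {x : V} (hxW : x ∈ W)
    (hx : B x x = 1) (hxc : B x c ≠ 0) : x ∈ Φ := by
  set τ : ZMod p := (1 - B b a) * (B b c)⁻¹ with hτ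
  set a' := a + τ • c with ha'
  have haΦ : a' ∈ Φ := add_smul_mem_of_mem_siegelModule ha haN (hΦ.norm a ha) τ
  have haW' : a' ∈ W := W.add_mem haW (W.smul_mem _ hcW)
  have hac' : B a' c = 0 := by simp [ha', haN.1, hc]
  have hba : B b a' = 1 := by
    simp only [ha', map_add, map_smul, smul_eq_mul, hτ]
    field_simp
    ring
  have hab : B a' b = 1 := (hs _ _).trans hba
  have hiso : B (b - a') (b - a') = 0 := by
    simp only [map_sub, LinearMap.sub_apply, hba, hab, hΦ.norm _ hb, hΦ.norm _ haΦ]; ring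
  have hperp : B a' (b - a') = 0 := by simp [hab, hΦ.norm _ haΦ]
  have hy : ∀ t : ZMod p, a' + t • (b - a') ∈ Φ := fun t ↦
    add_smul_mem_of_mem_siegelModule (h2 := h2) (hs := hs) (hc := hiso) haΦ
      (mem_siegelModule_of_add_smul_mem hΦ haΦ hperp one_ne_zero (by simpa using hb))
      (hΦ.norm _ haΦ) t
  set t := B x c * (B b c)⁻¹ with ht
  set y := a' + t • (b - a') with hyd
  have hyc : B y c = B x c := by
    simp only [hyd, map_add, map_sub, map_smul, LinearMap.add_apply, LinearMap.sub_apply,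
      LinearMap.smul_apply, smul_eq_mul, hac', ht]
    field_simp
    ring
  set u := (B x c)⁻¹ • (x - y) with hu
  have huW : u ∈ W := W.smul_mem _ (W.sub_mem hxW (W.add_mem haW' (W.smul_mem _
    (W.sub_mem hbW haW'))))
  have huc : B u c = 0 := by simp [hu, hyc]
  have hz := (hW u huW huc).2 1 y (hy t)
  rw [one_smul] at hz
  obtain ⟨κ, hκ⟩ : ∃ κ : ZMod p, siegel B c u y = x + κ • c := by
    refine ⟨-B y u - 2⁻¹ * B u u * B y c, ?_⟩
    rw [siegel, hyc]
    nth_rewrite 1 [hu]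
    rw [smul_smul, mul_inv_cancel₀ hxc]
    module
  have h3 := hΦ.norm _ hz
  rw [hκ] at h3 hz
  have hκ0 : κ = 0 := by
    have : 2 * κ * B x c = 0 := by
      simp only [map_add, map_smul, LinearMap.add_apply, LinearMap.smul_apply, smul_eq_mul, hx, hc,
        hs c x] at h3
      linear_combination h3
    simpa [h2, hxc] using this
  simpa [hκ0] using hz

lemma mem_of_norm_eq_one (hΦ : IsRootSet B Φ) {W : Submodule (ZMod p) V} {a b : V}
    (haW : a ∈ W) (hbW : b ∈ W) (ha : a ∈ Φ) (hb : b ∈ Φ) (haN : a ∈ siegelModule h2 hs hc Φ)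
    (hbc : B b c ≠ 0) (hcW : c ∈ W)
    (hW : ∀ u ∈ W, B u c = 0 → u ∈ siegelModule h2 hs hc Φ) {x : V} (hxW : x ∈ W)
    (hx : B x x = 1) : x ∈ Φ := by
  by_cases hxc : B x c = 0
  swap
  · exact mem_of_mul_ne_zero hΦ haW hbW ha hb haN hbc hcW hW hxW hx hxc
  obtain ⟨z, hzW, hz, hzx, hzc⟩ : ∃ z ∈ W, B z z = 1 ∧ B z x ≠ 0 ∧ B z c ≠ 0 := by
    by_cases hbx : B b x = 0
    · refine ⟨siegel B c x b, ?_, by rw [siegel_norm h2 hs hc hxc, hΦ.norm b hb], ?_, ?_⟩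
      · exact W.sub_mem (W.sub_mem (W.add_mem hbW (W.smul_mem _ hxW)) (W.smul_mem _ hcW))
          (W.smul_mem _ hcW)
      · have : B (siegel B c x b) x = B b c := by
          simp [siegel, hbx, hx, (hs c x).trans hxc]
        rwa [this]
      · have : B (siegel B c x b) c = B b c := by
          simp [siegel, hc, hxc]
        rwa [this]
    · exact ⟨b, hbW, hΦ.norm b hb, hbx, hbc⟩
  have hzΦ := mem_of_mul_ne_zero hΦ haW hbW ha hb haN hbc hcW hW hzW hz hzc
  have hxz : B x z ≠ 0 := by rwa [hs]
  have h3 : x - (2 * B x z) • z ∈ Φ := by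
    refine mem_of_mul_ne_zero hΦ haW hbW ha hb haN hbc hcW hW (W.sub_mem hxW (W.smul_mem _ hzW)) ?_
      ?_
    · simp only [map_sub, map_smul, LinearMap.sub_apply, LinearMap.smul_apply, smul_eq_mul, hx, hz,
        hs z x]
      ring
    · simp [hxc, h2, hxz, hzc]
  convert hΦ.refl z hzΦ _ h3 using 1
  simp only [map_sub, map_smul, LinearMap.sub_apply, LinearMap.smul_apply, smul_eq_mul, hz]
  module

end Siegel

section StringSystem

variable {p : ℕ} {V : Type*} [AddCommGroup V] [Module (ZMod p) V]

/-- A basis of norm-one vectors whose Gram matrix is tridiagonal with connected diagram. -/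
structure StringSystem (B : LinearMap.BilinForm (ZMod p) V) (b : ℕ → V) (n : ℕ) : Prop where
  symm : ∀ x y, B x y = B y x
  norm : ∀ i < n, B (b i) (b i) = 1
  adj : ∀ i, i + 1 < n → B (b i) (b (i + 1)) ≠ 0
  far : ∀ i j, i + 1 < j → j < n → B (b i) (b j) = 0
  linInd : LinearIndependent (ZMod p) fun i : Fin n ↦ b i

/-- The span of the vectors `b i` with `s ≤ i < t`. -/
def icoSpan (p : ℕ) {V : Type*} [AddCommGroup V] [Module (ZMod p) V] (b : ℕ → V) (s t : ℕ) :
    Submodule (ZMod p) V :=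
  Submodule.span (ZMod p) (b '' Set.Ico s t)

lemma mem_icoSpan {b : ℕ → V} {s t i : ℕ} (h : s ≤ i) (h' : i < t) : b i ∈ icoSpan p b s t :=
  Submodule.subset_span ⟨i, ⟨h, h'⟩, rfl⟩

lemma icoSpan_le {b : ℕ → V} {s t : ℕ} {W : Submodule (ZMod p) V}
    (h : ∀ i, s ≤ i → i < t → b i ∈ W) : icoSpan p b s t ≤ W := by
  rw [icoSpan, Submodule.span_le]
  rintro _ ⟨i, hi, rfl⟩
  exact h i hi.1 hi.2

lemma icoSpan_mono {b : ℕ → V} {s t s' t' : ℕ} (hs : s' ≤ s) (ht : t ≤ t') :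
    icoSpan p b s t ≤ icoSpan p b s' t' :=
  icoSpan_le fun _ h h' ↦ mem_icoSpan (hs.trans h) (h'.trans_le ht)

lemma exists_icoSpan_succ {b : ℕ → V} {s t : ℕ} (hst : s ≤ t) {x : V}
    (hx : x ∈ icoSpan p b s (t + 1)) : ∃ α : ZMod p, x - α • b t ∈ icoSpan p b s t := by
  have h : icoSpan p b s (t + 1) ≤ icoSpan p b s t ⊔ Submodule.span (ZMod p) {b t} :=
    icoSpan_le fun i h h' ↦ by
      rcases (Nat.lt_succ_iff_lt_or_eq).1 h' with h' | rfl
      · exact Submodule.mem_sup_left (mem_icoSpan h h')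
      · exact Submodule.mem_sup_right (Submodule.mem_span_singleton_self _)
  obtain ⟨y, hy, z, hz, rfl⟩ := Submodule.mem_sup.1 (h hx)
  obtain ⟨α, rfl⟩ := Submodule.mem_span_singleton.1 hz
  exact ⟨α, by simpa using hy⟩

lemma icoSpan_eq_bot {b : ℕ → V} {s t : ℕ} (h : t ≤ s) : icoSpan p b s t = ⊥ := by
  rw [icoSpan, Set.Ico_eq_empty (by omega), Set.image_empty, Submodule.span_empty]

variable {B : LinearMap.BilinForm (ZMod p) V} {b : ℕ → V} {n : ℕ}

variable [Fact p.Prime] {Φ : Set V}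

lemma mem_of_sq_eq_one (hΦ : IsRootSet B Φ) {x : V} (hx : x ∈ Φ) {α : ZMod p} (hα : α * α = 1) :
    α • x ∈ Φ := by
  rcases mul_self_eq_one_iff.1 hα with rfl | rfl
  · simpa using hx
  · simpa using hΦ.neg hx

lemma mem_siegelModule_of_hyperbolic {h2 : (2 : ZMod p) ≠ 0} {hs : ∀ x y, B x y = B y x}
    {c : V} {hc : B c c = 0} (h3 : (3 : ZMod p) ≠ 0) (hΦ : IsRootSet B Φ) {a f : V}
    (ha : a ∈ Φ) (hac : B a c = 0) (haf : B a f ≠ 0) (hcf : B c f = 2⁻¹) (hf : B f f = 0)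
    (hv : c + f ∈ Φ) (hv' : (2 : ZMod p) • c + (2⁻¹ : ZMod p) • f ∈ Φ) :
    a ∈ siegelModule h2 hs hc Φ := by
  have hs0 : 6 * B a f ≠ 0 := by
    have : (6 : ZMod p) = 2 * 3 := by norm_num
    rw [this]
    exact mul_ne_zero (mul_ne_zero h2 h3) haf
  refine mem_siegelModule_of_add_smul_mem hΦ ha hac hs0 ?_
  convert hΦ.refl _ hv' _ (hΦ.refl _ hv a ha) using 1
  have hfc : B f c = 2⁻¹ := (hs f c).trans hcf
  simp only [map_add, map_sub, map_smul, LinearMap.add_apply, LinearMap.sub_apply,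
    LinearMap.smul_apply, smul_eq_mul, hac, hc, hf, hcf, hfc]
  match_scalars
  · ring
  · field_simp
    ring
  · field_simp
    ring

/-- If the last branch of a segment is labelled by `-1`, then any root-closed set containing the
basis vectors of the segment contains all vectors of norm one in their span. -/
theorem StringSystem.mem_of_norm_eq_one (S : StringSystem B b n) (h2 : (2 : ZMod p) ≠ 0)
    (h3 : (3 : ZMod p) ≠ 0) (hΦ : IsRootSet B Φ) {s d : ℕ} (hsd : s ≤ d + 1) (hd : d + 1 < n)
    (hB : B (b d) (b (d + 1)) = -1) (hb : ∀ i, s ≤ i → i < d + 2 → b i ∈ Φ) {x : V}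
    (hx : x ∈ icoSpan p b s (d + 2)) (hxx : B x x = 1) : x ∈ Φ := by
  have hs := S.symm
  have hd0 := S.norm d (by omega)
  have hd1 := S.norm (d + 1) hd
  have hB' : B (b (d + 1)) (b d) = -1 := (hs _ _).trans hB
  obtain ⟨β, hβ⟩ := exists_icoSpan_succ hsd hx
  rcases Nat.eq_or_lt_of_le hsd with rfl | hsd'
  · rw [icoSpan_eq_bot le_rfl, Submodule.mem_bot, sub_eq_zero] at hβ
    rw [hβ] at hxx ⊢
    simp only [map_smul, LinearMap.smul_apply, hd1, smul_eq_mul, mul_one] at hxx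
    exact mem_of_sq_eq_one hΦ (hb _ le_rfl (by omega)) hxx
  set c := b d + b (d + 1) with hcd
  have hc : B c c = 0 := by
    simp only [hcd, map_add, LinearMap.add_apply, hd0, hd1, hB, hB']
    ring
  have hdc : B (b d) c = 0 := by
    simp only [hcd, map_add, hd0, hB]
    ring
  have hdΦ : b d ∈ Φ := hb d (by omega) (by omega)
  have hdΦ' : b (d + 1) ∈ Φ := hb (d + 1) (by omega) (by omega)
  have hdN : b d ∈ siegelModule h2 hs hc Φ :=
    mem_siegelModule_of_add_smul_mem hΦ hdΦ hdc (neg_ne_zero.2 one_ne_zero) (by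
      convert hΦ.neg hdΦ' using 1
      rw [hcd]; module)
  have hdN' : b (d + 1) ∈ siegelModule h2 hs hc Φ := by
    simpa [hcd] using sub_mem (self_mem_siegelModule (h2 := h2) (hs := hs) (hc := hc) (Φ := Φ)) hdN
  rcases Nat.eq_or_lt_of_le (Nat.le_of_lt_succ hsd') with rfl | hsd''
  · obtain ⟨α, hα⟩ := exists_icoSpan_succ le_rfl hβ
    rw [icoSpan_eq_bot le_rfl, Submodule.mem_bot, sub_sub, sub_eq_zero] at hα
    have hα1 : (α - β) * (α - β) = 1 := by
      rw [← hxx, hα]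
      simp only [map_add, map_smul, LinearMap.add_apply, LinearMap.smul_apply, smul_eq_mul, hd0,
        hd1, hB, hB']
      ring
    convert mem_of_sq_eq_one hΦ
      (add_smul_mem_of_mem_siegelModule hdΦ hdN hd0 (β * (α - β))) hα1 using 1
    rw [hα, hcd, smul_add, smul_smul, mul_left_comm, hα1]
    module
  obtain ⟨f, rfl⟩ : ∃ f, d = f + 1 := ⟨d - 1, by omega⟩
  have hf := S.adj f (by omega)
  have hf0 := S.norm f (by omega)
  have hfc : B (b f) c = B (b f) (b (f + 1)) := by
    rw [hcd, map_add, S.far f (f + 1 + 1) (by omega) (by omega), add_zero]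
  have hcf : B c (b f) = B (b f) (b (f + 1)) := (hs _ _).trans hfc
  have hcW : ∀ i, i ≤ f + 1 → c ∈ icoSpan p b i (f + 1 + 2) := fun i hi ↦
    add_mem (mem_icoSpan hi (by omega)) (mem_icoSpan (by omega) (by omega))
  have key : ∀ i, i ≤ f → (∀ j, i ≤ j → j < f → b j ∈ siegelModule h2 hs hc Φ) →
      ∀ u ∈ icoSpan p b i (f + 1 + 2), B u c = 0 → u ∈ siegelModule h2 hs hc Φ := by
    intro i hi hj u hu huc
    have h4 : icoSpan p b i (f + 1 + 2) ≤
        siegelModule h2 hs hc Φ ⊔ Submodule.span (ZMod p) {b f} := icoSpan_le fun j h h' ↦ by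
      rcases lt_trichotomy j f with h'' | rfl | h''
      · exact Submodule.mem_sup_left (hj j h h'')
      · exact Submodule.mem_sup_right (Submodule.mem_span_singleton_self _)
      · obtain rfl | rfl : j = f + 1 ∨ j = f + 1 + 1 := by omega
        · exact Submodule.mem_sup_left hdN
        · exact Submodule.mem_sup_left hdN'
    obtain ⟨y, hy, z, hz, rfl⟩ := Submodule.mem_sup.1 (h4 hu)
    obtain ⟨α, rfl⟩ := Submodule.mem_span_singleton.1 hz
    have e : B (y + α • b f) c = B y c + α * B (b f) c := by
      rw [map_add B, map_smul B, LinearMap.add_apply, LinearMap.smul_apply, smul_eq_mul]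
    rw [e, hy.1, zero_add, hfc] at huc
    rw [(mul_eq_zero.1 huc).resolve_right hf, zero_smul, add_zero]
    exact hy
  have conclude : ∀ i, s ≤ i → i ≤ f → (∀ j, i ≤ j → j < f → b j ∈ siegelModule h2 hs hc Φ) →
      ∀ u ∈ icoSpan p b i (f + 1 + 2), B u u = 1 → u ∈ Φ := fun i hi hi' hj u hu huu ↦
    Statement9.mem_of_norm_eq_one hΦ (mem_icoSpan (i := f + 1) (by omega) (by omega))
      (mem_icoSpan (i := f) (by omega) (by omega)) hdΦ (hb f (by omega) (by omega)) hdN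
      (by rwa [hfc]) (hcW i (by omega)) (key i hi' hj) hu huu
  refine conclude s le_rfl (by omega) ?_ x hx hxx
  suffices h : ∀ m j, s ≤ j → j + 1 + m = f → b j ∈ siegelModule h2 hs hc Φ from
    fun j hj hj' ↦ h (f - (j + 1)) j hj (by omega)
  have hjc : ∀ j < f, B (b j) c = 0 := fun j hj ↦ by
    rw [hcd, map_add, S.far _ _ (by omega) (by omega), S.far _ _ (by omega) (by omega), add_zero]
  intro m
  induction m with
  | zero =>
    rintro j hj rfl
    have h3dim := conclude (j + 1) (by omega) le_rfl fun i _ _ ↦ by omega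
    set l := B (b (j + 1)) (b (j + 1 + 1)) with hl
    set f := (2⁻¹ * l⁻¹) • (b (j + 1) - (2⁻¹ * l⁻¹) • c) with hfd
    have hff : B f f = 0 := by
      simp only [hfd, map_sub, map_smul, LinearMap.sub_apply, LinearMap.smul_apply, smul_eq_mul,
        hc, hf0, hfc, hcf]
      field_simp
      ring
    have hcf' : B c f = 2⁻¹ := by
      simp only [hfd, map_sub, map_smul, smul_eq_mul, hc, hcf]
      field_simp
      ring
    have hfc' : B f c = 2⁻¹ := (hs _ _).trans hcf'
    have hfW : f ∈ icoSpan p b (j + 1) (j + 1 + 1 + 2) :=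
      Submodule.smul_mem _ _ (sub_mem (mem_icoSpan le_rfl (by omega))
        (Submodule.smul_mem _ _ (hcW _ (by omega))))
    refine mem_siegelModule_of_hyperbolic h3 hΦ (f := f) (hb j hj (by omega)) (hjc j (by omega)) ?_
      hcf' hff (h3dim _ (add_mem (hcW _ (by omega)) hfW) ?_) (h3dim _ (add_mem
        (Submodule.smul_mem _ _ (hcW _ (by omega))) (Submodule.smul_mem _ _ hfW)) ?_)
    · simp only [hfd, map_sub, map_smul, hjc j (by omega), mul_zero, sub_zero, smul_eq_mul]
      exact mul_ne_zero (mul_ne_zero (inv_ne_zero h2) (inv_ne_zero hf)) (S.adj j (by omega))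
    · simp only [map_add, LinearMap.add_apply, hc, hff, hcf', hfc']
      field_simp
      ring
    · simp only [map_add, map_smul, LinearMap.add_apply, LinearMap.smul_apply, smul_eq_mul, hc, hff,
        hcf', hfc']
      field_simp
      ring
  | succ m ih =>
    intro j hj hjm
    have h4 := ih (j + 1) (by omega) (by omega)
    have h5 := refl_mem_siegelModule hΦ (hb j hj (by omega)) (hjc j (by omega)) h4
    have h6 := sub_mem h4 h5
    rw [sub_sub_cancel, Submodule.smul_mem_iff] at h6
    · exact h6
    · exact mul_ne_zero h2 (by rw [hs]; exact S.adj j (by omega))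

end StringSystem

section SegmentGroups

variable {p : ℕ} [Fact p.Prime] {V : Type*} [AddCommGroup V] [Module (ZMod p) V]

/-- The norm-one vectors whose reflections lie in a given group. -/
def rootSet (B : LinearMap.BilinForm (ZMod p) V) (H : Subgroup (Module.End (ZMod p) V)ˣ) : Set V :=
  {a | B a a = 1 ∧ reflUnit B a ∈ H}

/-- The group generated by the reflections in the vectors `b i` with `s ≤ i < t`. -/
def segGroup (B : LinearMap.BilinForm (ZMod p) V) (b : ℕ → V) (s t : ℕ) :
    Subgroup (Module.End (ZMod p) V)ˣ :=
  Subgroup.closure ((fun i ↦ reflUnit B (b i)) '' Set.Ico s t)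

variable {B : LinearMap.BilinForm (ZMod p) V} {b : ℕ → V} {n : ℕ}

lemma reflUnit_apply_of_norm {a : V} (ha : B a a = 1) (x : V) :
    (reflUnit B a).1 x = x - (2 * B x a) • a := by
  rw [reflUnit_apply, ha, inv_one, mul_one]

lemma isRootSet_rootSet (hs : ∀ x y, B x y = B y x) (H : Subgroup (Module.End (ZMod p) V)ˣ) :
    IsRootSet B (rootSet B H) where
  norm x hx := hx.1
  refl x hx y hy := by
    rw [← reflUnit_apply_of_norm hx.1]
    refine ⟨(reflUnit_isometry B hs x y y).trans hy.1, ?_⟩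
    rw [← reflUnit_conj B (reflUnit_isometry B hs x)]
    exact mul_mem (mul_mem hx.2 hy.2) (inv_mem hx.2)

lemma reflUnit_mem_segGroup {s t i : ℕ} (h : s ≤ i) (h' : i < t) :
    reflUnit B (b i) ∈ segGroup B b s t :=
  Subgroup.subset_closure ⟨i, ⟨h, h'⟩, rfl⟩

lemma segGroup_le {s t : ℕ} {H : Subgroup (Module.End (ZMod p) V)ˣ}
    (h : ∀ i, s ≤ i → i < t → reflUnit B (b i) ∈ H) : segGroup B b s t ≤ H := by
  rw [segGroup, Subgroup.closure_le]
  rintro _ ⟨i, hi, rfl⟩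
  exact h i hi.1 hi.2

lemma segGroup_le_isometries (hs : ∀ x y, B x y = B y x) (s t : ℕ) :
    segGroup B b s t ≤ isometries B :=
  segGroup_le fun _ _ _ ↦ reflUnit_isometry B hs _

lemma segGroup_le_trivialMod (s t : ℕ) :
    segGroup B b s t ≤ trivialMod (icoSpan p b s t) :=
  segGroup_le fun _ h h' ↦ reflUnit_mem_trivialMod B (mem_icoSpan h h')

lemma StringSystem.reflUnit_mem_of_isSquare (S : StringSystem B b n) (h2 : (2 : ZMod p) ≠ 0)
    (h3 : (3 : ZMod p) ≠ 0) {s d : ℕ} (hsd : s ≤ d + 1) (hd : d + 1 < n)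
    (hB : B (b d) (b (d + 1)) = -1) {a : V} (ha : a ∈ icoSpan p b s (d + 2)) (ha0 : B a a ≠ 0)
    (hsq : IsSquare (B a a)) : reflUnit B a ∈ segGroup B b s (d + 2) := by
  obtain ⟨t, ht⟩ := hsq
  have ht0 : t ≠ 0 := by
    rintro rfl
    exact ha0 (by rw [ht, mul_zero])
  have h := S.mem_of_norm_eq_one h2 h3 (isRootSet_rootSet S.symm (segGroup B b s (d + 2))) hsd hd hB
    (fun i hi hi' ↦ ⟨S.norm i (by omega), reflUnit_mem_segGroup hi hi'⟩)
    (Submodule.smul_mem _ t⁻¹ ha) (by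
      simp only [map_smul, LinearMap.smul_apply, smul_eq_mul, ht]
      field_simp)
  rw [← reflUnit_smul B (inv_ne_zero ht0)]
  exact h.2

lemma exists_binary_eq (hp : p ≠ 2) {ν δ : ZMod p} (hν : ν ≠ 0) (h : δ * δ ≠ ν * ν) :
    ∃ x y : ZMod p, ν * x ^ 2 + 2 * δ * x * y + ν * y ^ 2 = 1 := by
  have he : ν * ν - δ * δ ≠ 0 := sub_ne_zero.2 h.symm
  have hcard : Fintype.card (ZMod p) % 2 = 1 := by
    rw [ZMod.card]
    exact (Fact.out : p.Prime).eq_two_or_odd.resolve_left hp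
  obtain ⟨X, y, hXy⟩ := FiniteField.exists_root_sum_quadratic
    (f := Polynomial.C 1 * Polynomial.X ^ 2 + Polynomial.C 0 * Polynomial.X + Polynomial.C 0)
    (g := Polynomial.C (ν * ν - δ * δ) * Polynomial.X ^ 2 + Polynomial.C 0 * Polynomial.X
      + Polynomial.C (-ν))
    (Polynomial.degree_quadratic one_ne_zero) (Polynomial.degree_quadratic he) hcard
  simp only [Polynomial.eval_add, Polynomial.eval_mul, Polynomial.eval_C, Polynomial.eval_pow,
    Polynomial.eval_X] at hXy
  refine ⟨(X - δ * y) * ν⁻¹, y, ?_⟩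
  field_simp
  linear_combination hXy

section Pair

variable {W : Submodule (ZMod p) V} {H : Subgroup (Module.End (ZMod p) V)ˣ}

lemma mul_mem_of_mul_self_ne (hp : p ≠ 2) (hs : ∀ x y, B x y = B y x)
    (hH : ∀ a ∈ W, B a a ≠ 0 → IsSquare (B a a) → reflUnit B a ∈ H) {a a' : V} (ha : a ∈ W)
    (ha' : a' ∈ W) {ν : ZMod p} (hν : ν ≠ 0) (haν : B a a = ν) (haν' : B a' a' = ν)
    (hne : B a a' * B a a' ≠ ν * ν) : reflUnit B a * reflUnit B a' ∈ H := by
  obtain ⟨x, y, hxy⟩ := exists_binary_eq hp hν hne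
  obtain ⟨e, he⟩ : ∃ e, B a a' = e * ν := ⟨B a a' * ν⁻¹, by field_simp⟩
  have hi : ν * ν⁻¹ = 1 := mul_inv_cancel₀ hν
  have he' : B a' a = e * ν := (hs _ _).trans he
  have hq : x ^ 2 + 2 * e * x * y + y ^ 2 = ν⁻¹ := by
    rw [he] at hxy
    field_simp
    linear_combination hxy
  set z := x • a + y • a' with hz
  set w := (x + 2 * y * e) • a' - y • a with hw
  have hzz : B z z = 1 := by
    simp only [hz, map_add, map_smul, LinearMap.add_apply, LinearMap.smul_apply, smul_eq_mul, haν,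
      haν', he, he']
    linear_combination ν * hq + hi
  have hww : B w w = 1 := by
    simp only [hw, map_sub, map_smul, LinearMap.sub_apply, LinearMap.smul_apply, smul_eq_mul, haν,
      haν', he, he']
    linear_combination ν * hq + hi
  have hwz : B w z = e := by
    simp only [hw, hz, map_add, map_sub, map_smul, LinearMap.sub_apply, LinearMap.smul_apply,
      smul_eq_mul, haν, haν', he, he']
    linear_combination e * ν * hq + e * hi
  have key : reflUnit B a * reflUnit B a' = reflUnit B z * reflUnit B w := by
    refine units_ext fun v ↦ ?_
    simp only [Units.val_mul, Module.End.mul_apply]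
    rw [reflUnit_apply_of_norm hzz, reflUnit_apply_of_norm hww, reflUnit_apply, reflUnit_apply]
    have h1 : B (v - (2 * B v w) • w) z = B v z - 2 * B v w * e := by simp [hwz]
    have hvz : B v z = x * B v a + y * B v a' := by simp [hz]
    have hvw : B v w = (x + 2 * y * e) * B v a' - y * B v a := by simp [hw]
    have h2 : B (v - (2 * B v a' * (B a' a')⁻¹) • a') a =
      B v a - 2 * B v a' * ν⁻¹ * (e * ν) := by simp [haν', he']
    rw [h1, h2, hvz, hvw, haν, haν', hz, hw]
    match_scalars
    · rfl
    · linear_combination 2 * B v a' * hq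
    · linear_combination (2 * B v a - 4 * B v a' * e) * hq + 4 * B v a' * e * ν⁻¹ * hi
  rw [key]
  refine mul_mem (hH z ?_ ?_ ?_) (hH w ?_ ?_ ?_)
  · exact add_mem (W.smul_mem _ ha) (W.smul_mem _ ha')
  · rw [hzz]; exact one_ne_zero
  · rw [hzz]; exact IsSquare.one
  · exact sub_mem (W.smul_mem _ ha') (W.smul_mem _ ha)
  · rw [hww]; exact one_ne_zero
  · rw [hww]; exact IsSquare.one

lemma mul_mem_trans {a d a' : V} (h : reflUnit B a * reflUnit B d ∈ H)
    (h' : reflUnit B d * reflUnit B a' ∈ H) : reflUnit B a * reflUnit B a' ∈ H := by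
  have := mul_mem h h'
  rwa [mul_assoc, ← mul_assoc (reflUnit B d), reflUnit_mul_self, one_mul] at this

lemma mul_mem_of_form_eq (hp : p ≠ 2) (h2 : (2 : ZMod p) ≠ 0) (h3 : (3 : ZMod p) ≠ 0)
    (hs : ∀ x y, B x y = B y x)
    (hH : ∀ a ∈ W, B a a ≠ 0 → IsSquare (B a a) → reflUnit B a ∈ H)
    (hW : ∀ a ∈ W, (∀ v ∈ W, B v v = 1 → B a v = 0) → ∀ v ∈ W, B a v = 0) {a a' : V}
    (ha : a ∈ W) (ha' : a' ∈ W) {ν : ZMod p} (hν : ¬ IsSquare ν) (haν : B a a = ν)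
    (haν' : B a' a' = ν) (he : B a a' = ν) : reflUnit B a * reflUnit B a' ∈ H := by
  have hν0 : ν ≠ 0 := fun h ↦ hν (h ▸ IsSquare.zero)
  have he' : B a' a = ν := (hs _ _).trans he
  set c := a' - a with hc
  have hcW : c ∈ W := sub_mem ha' ha
  have ha'c : a' = a + c := by rw [hc]; module
  have hcc : B c c = 0 := by
    simp only [hc, map_sub, LinearMap.sub_apply, haν, haν', he, he']; ring
  have hca : B c a = 0 := by simp [hc, haν, he']
  by_cases hcperp : ∀ w ∈ W, B c w = 0
  · obtain ⟨v, hvW, hv, hav⟩ : ∃ v ∈ W, B v v = 1 ∧ B a v ≠ 0 := by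
      by_contra! hno
      exact hν0 (haν ▸ hW a ha hno a ha)
    set d := (reflUnit B v).1 a with hd
    have hd' : d = a - (2 * B a v) • v := reflUnit_apply_of_norm hv a
    have hdW : d ∈ W := by rw [hd']; exact sub_mem ha (W.smul_mem _ hvW)
    have hdd : B d d = ν := (reflUnit_isometry B hs v a a).trans haν
    have h4 : reflUnit B a * reflUnit B d ∈ H := by
      rw [hd, ← reflUnit_conj B (reflUnit_isometry B hs v), reflUnit_inv]
      have h5 := reflUnit_conj B (reflUnit_isometry B hs a) v
      rw [reflUnit_inv] at h5
      rw [← mul_assoc, ← mul_assoc, h5]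
      have h6 : B ((reflUnit B a).1 v) ((reflUnit B a).1 v) = 1 :=
        (reflUnit_isometry B hs a v v).trans hv
      refine mul_mem (hH _ ?_ (h6 ▸ one_ne_zero) (h6 ▸ IsSquare.one))
        (hH v hvW (hv ▸ one_ne_zero) (hv ▸ IsSquare.one))
      rw [reflUnit_apply]
      exact sub_mem hvW (W.smul_mem _ ha)
    refine mul_mem_trans h4 (mul_mem_of_mul_self_ne hp hs hH hdW ha' hν0 hdd haν' ?_)
    have h5 : B d a' = ν - 2 * (B a v * B a v) := by
      rw [ha'c, map_add, hs d c, hcperp d hdW, hd']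
      simp only [map_sub, map_smul, LinearMap.sub_apply, LinearMap.smul_apply, smul_eq_mul, haν,
        hs v a]
      ring
    rw [h5]
    intro h6
    have h7 : 2 * 2 * (B a v * B a v) * (B a v * B a v - ν) = 0 := by linear_combination h6
    have h8 : B a v * B a v - ν = 0 := by simpa [h2, hav] using h7
    exact hν ⟨B a v, (sub_eq_zero.1 h8).symm⟩
  · push Not at hcperp
    obtain ⟨f₀, hf₀W, hf₀⟩ := hcperp
    obtain ⟨f₁, hf₁W, hf₁c, hf₁a⟩ : ∃ f ∈ W, B c f = 1 ∧ B f a = 0 := by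
      refine ⟨(B c f₀)⁻¹ • (f₀ - (B f₀ a * ν⁻¹) • a),
        W.smul_mem _ (sub_mem hf₀W (W.smul_mem _ ha)), ?_, ?_⟩
      · simp only [map_sub, map_smul, smul_eq_mul, hca]
        field_simp
        ring
      · simp only [map_sub, map_smul, LinearMap.sub_apply, LinearMap.smul_apply, smul_eq_mul, haν]
        field_simp
        ring
    have hf₁c' : B f₁ c = 1 := (hs _ _).trans hf₁c
    set d := (4⁻¹ : ZMod p) • c + (2 * ν) • (f₁ - (2⁻¹ * B f₁ f₁) • c) with hd
    have h4 : (4 : ZMod p) ≠ 0 := by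
      have : (4 : ZMod p) = 2 * 2 := by norm_num
      rw [this]; exact mul_ne_zero h2 h2
    have hdW : d ∈ W := add_mem (W.smul_mem _ hcW)
      (W.smul_mem _ (sub_mem hf₁W (W.smul_mem _ hcW)))
    have hdd : B d d = ν := by
      simp only [hd, map_add, map_sub, map_smul, LinearMap.add_apply, LinearMap.sub_apply,
        LinearMap.smul_apply, smul_eq_mul, hcc, hf₁c, hf₁c']
      field_simp
      ring
    have hda : B d a = 0 := by simp [hd, hca, hf₁a]
    have hdc : B d c = 2 * ν := by simp [hd, hcc, hf₁c']
    refine mul_mem_trans (mul_mem_of_mul_self_ne hp hs hH ha hdW hν0 haν hdd ?_)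
      (mul_mem_of_mul_self_ne hp hs hH hdW ha' hν0 hdd haν' ?_)
    · rw [hs, hda, mul_zero]
      exact (mul_ne_zero hν0 hν0).symm
    · rw [ha'c, map_add, hda, hdc, zero_add]
      intro h5
      have h6 : 3 * (ν * ν) = 0 := by linear_combination h5
      simp [h3, hν0] at h6

lemma mul_mem_of_not_isSquare (hp : p ≠ 2) (h2 : (2 : ZMod p) ≠ 0) (h3 : (3 : ZMod p) ≠ 0)
    (hs : ∀ x y, B x y = B y x)
    (hH : ∀ a ∈ W, B a a ≠ 0 → IsSquare (B a a) → reflUnit B a ∈ H)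
    (hW : ∀ a ∈ W, (∀ v ∈ W, B v v = 1 → B a v = 0) → ∀ v ∈ W, B a v = 0) {a a' : V}
    (ha : a ∈ W) (ha' : a' ∈ W) (hν : ¬ IsSquare (B a a)) (hν' : ¬ IsSquare (B a' a')) :
    reflUnit B a * reflUnit B a' ∈ H := by
  have hν0 : B a a ≠ 0 := fun h ↦ hν (h ▸ IsSquare.zero)
  have hν0' : B a' a' ≠ 0 := fun h ↦ hν' (h ▸ IsSquare.zero)
  obtain ⟨t, ht⟩ := isSquare_mul_of_not hp hν hν'
  have ht0 : t * (B a' a')⁻¹ ≠ 0 := by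
    refine mul_ne_zero ?_ (inv_ne_zero hν0')
    rintro rfl
    exact mul_ne_zero hν0 hν0' (by simpa using ht)
  rw [← reflUnit_smul B ht0 a']
  set d := (t * (B a' a')⁻¹) • a' with hd
  have hdW : d ∈ W := W.smul_mem _ ha'
  have hdd : B d d = B a a := by
    simp only [hd, map_smul, LinearMap.smul_apply, smul_eq_mul]
    field_simp
    linear_combination -ht
  by_cases hne : B a d * B a d = B a a * B a a
  · rcases mul_self_eq_mul_self_iff.1 hne with h | h
    · exact mul_mem_of_form_eq hp h2 h3 hs hH hW ha hdW hν rfl hdd h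
    · rw [← reflUnit_smul B (neg_ne_zero.2 one_ne_zero) d]
      refine mul_mem_of_form_eq hp h2 h3 hs hH hW ha (W.smul_mem _ hdW) hν rfl ?_ ?_
      · simpa using hdd
      · simp [h]
  · exact mul_mem_of_mul_self_ne hp hs hH ha hdW hν0 rfl hdd hne

lemma mem_or_of_mem_reflGroup (hp : p ≠ 2) (h2 : (2 : ZMod p) ≠ 0) (h3 : (3 : ZMod p) ≠ 0)
    (hs : ∀ x y, B x y = B y x)
    (hH : ∀ a ∈ W, B a a ≠ 0 → IsSquare (B a a) → reflUnit B a ∈ H)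
    (hW : ∀ a ∈ W, (∀ v ∈ W, B v v = 1 → B a v = 0) → ∀ v ∈ W, B a v = 0)
    {g : (Module.End (ZMod p) V)ˣ} (hg : g ∈ reflGroup B W) :
    g ∈ H ∨ ∃ a ∈ W, ¬ IsSquare (B a a) ∧ ∃ h ∈ H, g = reflUnit B a * h := by
  have step : ∀ a ∈ W, B a a ≠ 0 → ∀ g : (Module.End (ZMod p) V)ˣ,
      (g ∈ H ∨ ∃ a ∈ W, ¬ IsSquare (B a a) ∧ ∃ h ∈ H, g = reflUnit B a * h) →
      (reflUnit B a * g ∈ H ∨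
        ∃ a' ∈ W, ¬ IsSquare (B a' a') ∧ ∃ h ∈ H, reflUnit B a * g = reflUnit B a' * h) := by
    intro a ha ha0 g hg
    by_cases hsq : IsSquare (B a a)
    · have haH := hH a ha ha0 hsq
      rcases hg with hg | ⟨a', ha', hν', h, hh, rfl⟩
      · exact Or.inl (mul_mem haH hg)
      · refine Or.inr ⟨(reflUnit B a).1 a', ?_, ?_, reflUnit B a * h, mul_mem haH hh, ?_⟩
        · rw [reflUnit_apply]
          exact sub_mem ha' (W.smul_mem _ ha)
        · rwa [reflUnit_isometry B hs]
        · rw [← reflUnit_conj B (reflUnit_isometry B hs a)]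
          group
    · rcases hg with hg | ⟨a', ha', hν', h, hh, rfl⟩
      · exact Or.inr ⟨a, ha, hsq, g, hg, rfl⟩
      · rw [← mul_assoc]
        exact Or.inl (mul_mem (mul_mem_of_not_isSquare hp h2 h3 hs hH hW ha ha' hsq hν') hh)
  induction hg using Subgroup.closure_induction_left with
  | one => exact Or.inl (one_mem _)
  | mul_left x hx y hy ih =>
    obtain ⟨a, ha, ha0, rfl⟩ := hx
    exact step a ha ha0 y ih
  | inv_mul_cancel x hx y hy ih =>
    obtain ⟨a, ha, ha0, rfl⟩ := hx
    exact step a ha ha0 y ih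

end Pair

lemma segGroup_le_map_ker [Finite V] (hp : p ≠ 2) (h2 : (2 : ZMod p) ≠ 0)
    (S : StringSystem B b n) {ν : ZMod p} (hν : ¬ IsSquare ν) {s t : ℕ} (ht : t ≤ n) :
    segGroup B b s t ≤ (sphereSign B ν).ker.map (isometries B).subtype :=
  segGroup_le fun i _ h ↦ ⟨⟨_, reflUnit_isometry B S.symm (b i)⟩,
    sphereSign_reflUnit_of_isSquare hp S.symm h2 hν (by simp [S.norm i (by omega)])
      (by simp [S.norm i (by omega)]), rfl⟩

lemma StringSystem.inf_icoSpan (S : StringSystem B b n) {s t : ℕ} (hst : s ≤ t) (ht : t ≤ n) :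
    icoSpan p b 0 t ⊓ icoSpan p b s n ≤ icoSpan p b s t := by
  have himg : ∀ s t, t ≤ n → b '' Set.Ico s t = (fun i : Fin n ↦ b i) '' {i | s ≤ i.1 ∧ i.1 < t} :=
    fun s t ht ↦ by
      ext x
      constructor
      · rintro ⟨i, hi, rfl⟩
        exact ⟨⟨i, hi.2.trans_le ht⟩, hi, rfl⟩
      · rintro ⟨i, hi, rfl⟩
        exact ⟨i, hi, rfl⟩
  have hdis : Disjoint (icoSpan p b 0 s) (icoSpan p b s n) := by
    rw [icoSpan, icoSpan, himg _ _ (hst.trans ht), himg _ _ le_rfl]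
    refine S.linInd.disjoint_span_image (Set.disjoint_left.2 fun i hi hi' ↦ ?_)
    exact absurd hi.2 (not_lt.2 hi'.1)
  rintro x ⟨hx, hx'⟩
  have hle : icoSpan p b 0 t ≤ icoSpan p b 0 s ⊔ icoSpan p b s t := icoSpan_le fun i _ hi ↦ by
    rcases lt_or_ge i s with h | h
    · exact Submodule.mem_sup_left (mem_icoSpan (Nat.zero_le _) h)
    · exact Submodule.mem_sup_right (mem_icoSpan h hi)
  obtain ⟨y, hy, z, hz, rfl⟩ := Submodule.mem_sup.1 (hle hx)
  have hyn : y ∈ icoSpan p b s n := by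
    simpa using sub_mem hx' (icoSpan_mono le_rfl ht hz)
  rw [Submodule.disjoint_def.1 hdis y hy hyn, zero_add]
  exact hz

lemma StringSystem.form_eq_zero (S : StringSystem B b n) {s t j : ℕ} (htj : t < j) (hj : j < n)
    {x : V} (hx : x ∈ icoSpan p b s t) : B x (b j) = 0 := by
  have h : icoSpan p b s t ≤ LinearMap.ker (B.flip (b j)) := icoSpan_le fun i _ hi ↦
    S.far i j (by omega) hj
  exact h hx

lemma StringSystem.eq_zero_of_form_eq_zero (S : StringSystem B b n) {s t : ℕ} (ht : t < n) {x : V}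
    (hx : x ∈ icoSpan p b s t) (h : ∀ i, s < i → i ≤ t → B x (b i) = 0) : x = 0 := by
  induction t with
  | zero => rwa [icoSpan_eq_bot (Nat.zero_le _)] at hx
  | succ t ih =>
    rcases Nat.lt_or_ge t s with hts | hts
    · rwa [icoSpan_eq_bot (by omega)] at hx
    · obtain ⟨α, hα⟩ := exists_icoSpan_succ hts hx
      have h4 := S.form_eq_zero (j := t + 1) (by omega) ht hα
      rw [map_sub, map_smul, LinearMap.sub_apply, LinearMap.smul_apply, h _ (by omega) le_rfl,
        zero_sub, neg_eq_zero, smul_eq_mul] at h4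
      rw [(mul_eq_zero.1 h4).resolve_right (S.adj t ht), zero_smul, sub_zero] at hα
      exact ih (by omega) hα fun i hi hi' ↦ h i hi (by omega)

lemma StringSystem.exists_smul_eq (S : StringSystem B b n) {s t : ℕ} (hst : s ≤ t) (ht : t < n)
    {c d : V} (hc : c ∈ icoSpan p b s (t + 1)) (hd : d ∈ icoSpan p b s (t + 1))
    (hcW : ∀ w ∈ icoSpan p b s (t + 1), B c w = 0) (hdW : ∀ w ∈ icoSpan p b s (t + 1), B d w = 0)
    (hc0 : c ≠ 0) : ∃ α : ZMod p, d = α • c := by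
  obtain ⟨γ, hγ⟩ := exists_icoSpan_succ hst hc
  obtain ⟨δ, hδ⟩ := exists_icoSpan_succ hst hd
  have hγ0 : γ ≠ 0 := by
    rintro rfl
    rw [zero_smul, sub_zero] at hγ
    exact hc0 (S.eq_zero_of_form_eq_zero ht hγ fun i hi hi' ↦
      hcW _ (mem_icoSpan hi.le (by omega)))
  refine ⟨δ * γ⁻¹, sub_eq_zero.1 (S.eq_zero_of_form_eq_zero (s := s) ht ?_ fun i hi hi' ↦ ?_)⟩
  · convert sub_mem hδ (Submodule.smul_mem _ (δ * γ⁻¹) hγ) using 1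
    rw [smul_sub, smul_smul, inv_mul_cancel_right₀ hγ0]
    module
  · have hiW : b i ∈ icoSpan p b s (t + 1) := mem_icoSpan hi.le (by omega)
    simp [hcW _ hiW, hdW _ hiW]

/-- The intersection property for an initial and a final segment, when the last branch of their
intersection is labelled by `-1`. -/
theorem StringSystem.inf_segGroup_of_neg_one [Finite V] (S : StringSystem B b n) (hp : p ≠ 2)
    (h2 : (2 : ZMod p) ≠ 0) (h3 : (3 : ZMod p) ≠ 0) {s d : ℕ} (hsd : s ≤ d + 1) (hd : d + 2 < n)
    (hB : B (b d) (b (d + 1)) = -1) :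
    segGroup B b 0 (d + 2) ⊓ segGroup B b s n ≤ segGroup B b s (d + 2) := by
  rintro g ⟨hg, hg'⟩
  have hgW : g ∈ trivialMod (icoSpan p b s (d + 2)) := fun x ↦
    S.inf_icoSpan (by omega) (by omega)
      ⟨segGroup_le_trivialMod 0 (d + 2) hg x, segGroup_le_trivialMod s n hg' x⟩
  have hH := fun a ha h h' ↦ S.reflUnit_mem_of_isSquare h2 h3 (a := a) hsd (by omega) hB ha h h'
  have hW : ∀ a ∈ icoSpan p b s (d + 2), (∀ v ∈ icoSpan p b s (d + 2), B v v = 1 → B a v = 0) →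
      ∀ v ∈ icoSpan p b s (d + 2), B a v = 0 := fun a _ h ↦ by
    have : icoSpan p b s (d + 2) ≤ LinearMap.ker (B a) := icoSpan_le fun i hi hi' ↦
      h _ (mem_icoSpan hi hi') (S.norm i (by omega))
    exact fun v hv ↦ this hv
  have hrefl : g ∈ reflGroup B (icoSpan p b s (d + 2)) := mem_reflGroup S.symm h2 _
    (fun c hc d' hd' h h' h0 ↦ S.exists_smul_eq hsd (by omega) hc hd' h h' h0)
    (fun x hx h ↦ S.eq_zero_of_form_eq_zero hd hx fun i _ _ ↦ h _) g
    (segGroup_le_isometries S.symm _ _ hg) hgW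
  rcases mem_or_of_mem_reflGroup hp h2 h3 S.symm hH hW hrefl with h | ⟨a, ha, hν, h, hh, rfl⟩
  · exact h
  · have h4 := segGroup_le_map_ker hp h2 S hν (by omega) hg
    have h5 := segGroup_le_map_ker hp h2 S hν (by omega) hh
    have h6 := (mul_mem_cancel_right h5).1 h4
    obtain ⟨k, hk, hk'⟩ := h6
    have h7 : k = ⟨reflUnit B a, reflUnit_isometry B S.symm a⟩ := Subtype.ext hk'
    rw [SetLike.mem_coe, MonoidHom.mem_ker, h7,
      sphereSign_reflUnit_of_not_isSquare hp S.symm h2 hν hν] at hk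
    exact absurd hk (by decide)

end SegmentGroups

section Generation

variable {Γ : Type*} [Group Γ]

lemma exists_mul_eq_of_mem_closure_union {A A' : Set Γ} (h : ∀ a ∈ A, ∀ b ∈ A', a * b = b * a)
    {g : Γ} (hg : g ∈ Subgroup.closure (A ∪ A')) :
    ∃ x ∈ Subgroup.closure A, ∃ y ∈ Subgroup.closure A', g = x * y := by
  have hc : ∀ x ∈ Subgroup.closure A, ∀ b ∈ A', x * b = b * x := fun x hx b hb ↦ by
    have hle : Subgroup.closure A ≤ Subgroup.centralizer A' := by
      rw [Subgroup.closure_le]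
      exact fun a ha ↦ Subgroup.mem_centralizer_iff.2 fun b hb ↦ (h a ha b hb).symm
    exact (Subgroup.mem_centralizer_iff.1 (hle hx) b hb).symm
  induction hg using Subgroup.closure_induction_left with
  | one => exact ⟨1, one_mem _, 1, one_mem _, (one_mul 1).symm⟩
  | mul_left a ha _ _ ih =>
    obtain ⟨x, hx, y, hy, rfl⟩ := ih
    rcases ha with ha | ha
    · exact ⟨a * x, mul_mem (Subgroup.subset_closure ha) hx, y, hy, (mul_assoc _ _ _).symm⟩
    · refine ⟨x, hx, a * y, mul_mem (Subgroup.subset_closure ha) hy, ?_⟩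
      rw [← mul_assoc, ← mul_assoc, hc x hx a ha]
  | inv_mul_cancel a ha _ _ ih =>
    obtain ⟨x, hx, y, hy, rfl⟩ := ih
    rcases ha with ha | ha
    · exact ⟨a⁻¹ * x, mul_mem (inv_mem (Subgroup.subset_closure ha)) hx, y, hy,
        (mul_assoc _ _ _).symm⟩
    · refine ⟨x, hx, a⁻¹ * y, mul_mem (inv_mem (Subgroup.subset_closure ha)) hy, ?_⟩
      rw [inv_mul_eq_iff_eq_mul, ← mul_assoc a, ← hc x hx a ha]
      group

lemma mem_closure_diff_singleton {ρ : ℕ → Γ} {n : ℕ}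
    (hcomm : ∀ i j, i + 1 < j → j < n → ρ i * ρ j = ρ j * ρ i)
    (hseg : ∀ s t, s ≤ n → t ≤ n →
      Subgroup.closure (ρ '' Set.Ico 0 t) ⊓ Subgroup.closure (ρ '' Set.Ico s n) ≤
        Subgroup.closure (ρ '' Set.Ico s t))
    {I : Set ℕ} (hI : ∀ j ∈ I, j < n) {i : ℕ} (hi : i ∈ I) {g : Γ}
    (hg : g ∈ Subgroup.closure (ρ '' I))
    (hg' : g ∈ Subgroup.closure (ρ '' {j | j < n ∧ j ≠ i})) :
    g ∈ Subgroup.closure (ρ '' (I \ {i})) := by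
  classical
  have hin := hI i hi
  have mono : ∀ {S T : Set ℕ}, S ⊆ T → Subgroup.closure (ρ '' S) ≤ Subgroup.closure (ρ '' T) :=
    fun h ↦ Subgroup.closure_mono (Set.image_mono h)
  have exs : ∃ s, ∀ j, s ≤ j → j ≤ i → j ∈ I := ⟨i, fun j h h' ↦ le_antisymm h h' ▸ hi⟩
  have exe : ∃ e, i < e ∧ e ∉ I := ⟨n, hin, fun h ↦ lt_irrefl _ (hI n h)⟩
  obtain ⟨s, hs, hs'⟩ : ∃ s, (∀ j, s ≤ j → j ≤ i → j ∈ I) ∧ ∀ m < s, ¬ ∀ j, m ≤ j → j ≤ i → j ∈ I :=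
    ⟨Nat.find exs, Nat.find_spec exs, fun m hm ↦ Nat.find_min exs hm⟩
  obtain ⟨e, he, he'⟩ : ∃ e, (i < e ∧ e ∉ I) ∧ ∀ m < e, ¬ (i < m ∧ m ∉ I) :=
    ⟨Nat.find exe, Nat.find_spec exe, fun m hm ↦ Nat.find_min exe hm⟩
  have hsi : s ≤ i := by
    by_contra h
    exact hs' i (not_le.1 h) fun j hj hj' ↦ le_antisymm hj hj' ▸ hi
  have hen : e ≤ n := by
    by_contra h
    exact he' n (not_le.1 h) ⟨hin, fun h ↦ lt_irrefl _ (hI n h)⟩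
  have hIco : ∀ j, s ≤ j → j < e → j ∈ I := fun j hj hj' ↦ by
    rcases le_or_gt j i with h | h
    · exact hs j hj h
    · by_contra hjI
      exact he' j hj' ⟨h, hjI⟩
  have hlow : ∀ j ∈ I, j < s → j + 1 < s := fun j hj hjs ↦ by
    by_contra h
    have : s = j + 1 := by omega
    refine hs' j hjs fun m hm hm' ↦ ?_
    rcases Nat.eq_or_lt_of_le hm with rfl | hm
    · exact hj
    · exact hs m (by omega) hm'
  have hhigh : ∀ j ∈ I, e ≤ j → e < j := fun j hj hje ↦
    lt_of_le_of_ne hje fun h ↦ he.2 (h ▸ hj)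
  have hsplit : ρ '' I = ρ '' (I \ Set.Ico s e) ∪ ρ '' Set.Ico s e := by
    rw [← Set.image_union, Set.sdiff_union_of_subset fun j hj ↦ hIco j hj.1 hj.2]
  rw [hsplit] at hg
  obtain ⟨x, hx, y, hy, rfl⟩ := exists_mul_eq_of_mem_closure_union (by
    rintro _ ⟨j, ⟨hj, hj'⟩, rfl⟩ _ ⟨m, ⟨hm, hm'⟩, rfl⟩
    rcases lt_or_ge j s with h | h
    · exact hcomm j m (by have := hlow j hj h; omega) (by omega)
    · have h1 : e ≤ j := by
        by_contra h2
        exact hj' ⟨h, not_le.1 h2⟩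
      have := hhigh j hj h1
      exact (hcomm m j (by omega) (hI j hj)).symm) hg
  have hne : ∀ j ∈ I \ Set.Ico s e, j ≠ i := by
    rintro j hj rfl
    exact hj.2 ⟨hsi, he.1⟩
  have hsub : I \ Set.Ico s e ⊆ {j | j < n ∧ j ≠ i} := fun j hj ↦ ⟨hI j hj.1, hne j hj⟩
  have hy' : y ∈ Subgroup.closure (ρ '' {j | j < n ∧ j ≠ i}) :=
    (mul_mem_cancel_left (mono hsub hx)).1 hg'
  have hsplit' : ρ '' {j | j < n ∧ j ≠ i} = ρ '' Set.Ico 0 i ∪ ρ '' Set.Ico (i + 1) n := by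
    rw [← Set.image_union]
    congr 1
    ext j
    simp only [Set.mem_ofPred_eq, Set.mem_union, Set.mem_Ico]
    omega
  rw [hsplit'] at hy'
  obtain ⟨h₁, hh₁, h₂, hh₂, rfl⟩ := exists_mul_eq_of_mem_closure_union (by
    rintro _ ⟨j, ⟨-, hj⟩, rfl⟩ _ ⟨m, ⟨hm, hm'⟩, rfl⟩
    exact hcomm j m (by omega) hm') hy'
  have k₁ : h₁ ∈ Subgroup.closure (ρ '' Set.Ico s i) := hseg s i (by omega) (by omega) ⟨hh₁,
    (mul_mem_cancel_right (mono (Set.Ico_subset_Ico_left (by omega)) hh₂)).1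
      (mono (Set.Ico_subset_Ico_right hen) hy)⟩
  have k₂ : h₂ ∈ Subgroup.closure (ρ '' Set.Ico (i + 1) e) := hseg (i + 1) e (by omega) hen
    ⟨(mul_mem_cancel_left (mono (Set.Ico_subset_Ico_right he.1.le) hh₁)).1
      (mono (Set.Ico_subset_Ico_left (Nat.zero_le s)) hy), hh₂⟩
  have hsub₀ : I \ Set.Ico s e ⊆ I \ {i} := fun j hj ↦ ⟨hj.1, hne j hj⟩
  have hsub₁ : Set.Ico s i ⊆ I \ {i} := fun j hj ↦ ⟨hIco j hj.1 (hj.2.trans he.1), hj.2.ne⟩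
  have hsub₂ : Set.Ico (i + 1) e ⊆ I \ {i} := fun j hj ↦
    ⟨hIco j (hsi.trans (Nat.le_of_succ_le hj.1)) hj.2, (Nat.lt_of_succ_le hj.1).ne'⟩
  exact mul_mem (mono hsub₀ hx) (mul_mem (mono hsub₁ k₁) (mono hsub₂ k₂))

/-- For generators indexed by a string diagram, the intersection property follows from the case of
an initial and a final segment. -/
theorem closure_inf_closure_le {ρ : ℕ → Γ} {n : ℕ}
    (hcomm : ∀ i j, i + 1 < j → j < n → ρ i * ρ j = ρ j * ρ i)
    (hseg : ∀ s t, s ≤ n → t ≤ n →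
      Subgroup.closure (ρ '' Set.Ico 0 t) ⊓ Subgroup.closure (ρ '' Set.Ico s n) ≤
        Subgroup.closure (ρ '' Set.Ico s t))
    {I J : Set ℕ} (hI : ∀ j ∈ I, j < n) (hJ : ∀ j ∈ J, j < n) :
    Subgroup.closure (ρ '' I) ⊓ Subgroup.closure (ρ '' J) ≤ Subgroup.closure (ρ '' (I ∩ J)) := by
  classical
  rintro g ⟨hg, hg'⟩
  have key : ∀ F : Finset ℕ, (∀ i ∈ F, i ∈ I ∧ i ∉ J) →
      g ∈ Subgroup.closure (ρ '' (I \ (F : Set ℕ))) := by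
    intro F
    induction F using Finset.induction_on with
    | empty => intro _; simpa using hg
    | insert i F hiF ih =>
      intro hF
      have h1 := ih fun j hj ↦ hF j (Finset.mem_insert_of_mem hj)
      have hi := hF i (Finset.mem_insert_self i F)
      have hsub : J ⊆ {j | j < n ∧ j ≠ i} := fun j hj ↦ ⟨hJ j hj, by
        rintro rfl
        exact hi.2 hj⟩
      have hsub' : (I \ (F : Set ℕ)) \ {i} ⊆ I \ ((insert i F : Finset ℕ) : Set ℕ) :=
        fun j hj ↦ ⟨hj.1.1, fun h ↦ (Finset.mem_insert.1 (Finset.mem_coe.1 h)).elim hj.2 hj.1.2⟩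
      have h2 := mem_closure_diff_singleton hcomm hseg (fun j hj ↦ hI j hj.1)
        (show i ∈ I \ (F : Set ℕ) from ⟨hi.1, hiF⟩) h1
        (Subgroup.closure_mono (Set.image_mono hsub) hg')
      exact Subgroup.closure_mono (Set.image_mono hsub') h2
  have h1 := key ((Finset.range n).filter fun i ↦ i ∈ I ∧ i ∉ J) fun i hi ↦
    (Finset.mem_filter.1 hi).2
  have hsub : I \ ((Finset.range n).filter fun i ↦ i ∈ I ∧ i ∉ J : Finset ℕ) ⊆ I ∩ J :=
    fun j hj ↦ ⟨hj.1, by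
      by_contra hjJ
      exact hj.2 (by simp [hI j hj.1, hj.1, hjJ])⟩
  exact Subgroup.closure_mono (Set.image_mono hsub) h1

/-- The product `ρ s * ρ (s + 1) * ⋯ * ρ (s + j - 1)`. -/
def stringProd (ρ : ℕ → Γ) (s : ℕ) : ℕ → Γ
  | 0 => 1
  | j + 1 => stringProd ρ s j * ρ (s + j)

variable {ρ : ℕ → Γ} {s t : ℕ}

lemma stringProd_mul_comm (hcomm : ∀ i j, i + 1 < j → j < t → ρ i * ρ j = ρ j * ρ i)
    {j i : ℕ} (hi : s + j < i) (hit : i < t) :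
    stringProd ρ s j * ρ i = ρ i * stringProd ρ s j := by
  induction j with
  | zero => simp [stringProd]
  | succ j ih =>
    rw [stringProd, mul_assoc, hcomm _ _ (by omega) hit, ← mul_assoc, ih (by omega), mul_assoc]

lemma stringProd_mul_eq (hcomm : ∀ i j, i + 1 < j → j < t → ρ i * ρ j = ρ j * ρ i)
    (hbraid : ∀ i, i + 1 < t → ρ i * ρ (i + 1) * ρ i = ρ (i + 1) * ρ i * ρ (i + 1))
    {j i : ℕ} (hsi : s ≤ i) (hi : i + 1 < s + j) (hj : s + j ≤ t) :
    stringProd ρ s j * ρ i = ρ (i + 1) * stringProd ρ s j := by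
  induction j with
  | zero => omega
  | succ j ih =>
    rcases Nat.lt_or_ge (i + 1) (s + j) with h | h
    · rw [stringProd, mul_assoc, ← hcomm _ _ h (by omega), ← mul_assoc, ih h (by omega), mul_assoc]
    · obtain ⟨m, rfl⟩ : ∃ m, j = m + 1 := ⟨j - 1, by omega⟩
      obtain rfl : i = s + m := by omega
      have h1 : stringProd ρ s (m + 1 + 1) =
          stringProd ρ s m * (ρ (s + m) * ρ (s + m + 1)) := by
        rw [stringProd, stringProd, mul_assoc]; rfl
      have h2 := stringProd_mul_comm hcomm (s := s) (j := m) (i := s + m + 1) (by omega) (by omega)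
      rw [h1, mul_assoc, hbraid _ (by omega), mul_assoc, ← mul_assoc, h2, mul_assoc]

lemma exists_eq_mul_stringProd (hsq : ∀ i, ρ i * ρ i = 1)
    (hcomm : ∀ i j, i + 1 < j → j < t → ρ i * ρ j = ρ j * ρ i)
    (hbraid : ∀ i, i + 1 < t → ρ i * ρ (i + 1) * ρ i = ρ (i + 1) * ρ i * ρ (i + 1))
    (hst : s ≤ t) {g : Γ} (hg : g ∈ Subgroup.closure (ρ '' Set.Ico s t)) :
    ∃ h ∈ Subgroup.closure (ρ '' Set.Ico (s + 1) t), ∃ j, s + j ≤ t ∧ g = h * stringProd ρ s j := by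
  have mem : ∀ i, s < i → i < t → ρ i ∈ Subgroup.closure (ρ '' Set.Ico (s + 1) t) := fun i h h' ↦
    Subgroup.subset_closure ⟨i, ⟨h, h'⟩, rfl⟩
  have hinv : ∀ i, (ρ i)⁻¹ = ρ i := fun i ↦ inv_eq_of_mul_eq_one_left (hsq i)
  have step : ∀ i ∈ Set.Ico s t, ∀ g, (∃ h ∈ Subgroup.closure (ρ '' Set.Ico (s + 1) t), ∃ j,
      s + j ≤ t ∧ g = h * stringProd ρ s j) → ∃ h ∈ Subgroup.closure (ρ '' Set.Ico (s + 1) t),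
        ∃ j, s + j ≤ t ∧ g * ρ i = h * stringProd ρ s j := by
    rintro i ⟨hsi, hit⟩ _ ⟨h, hh, j, hj, rfl⟩
    rcases lt_trichotomy i (s + j) with hij | rfl | hij
    · rcases Nat.lt_or_ge (i + 1) (s + j) with hij' | hij'
      · exact ⟨h * ρ (i + 1), mul_mem hh (mem _ (by omega) (by omega)), j, hj, by
          rw [mul_assoc, stringProd_mul_eq hcomm hbraid hsi hij' hj, mul_assoc]⟩
      · obtain ⟨m, rfl⟩ : ∃ m, j = m + 1 := ⟨j - 1, by omega⟩
        obtain rfl : i = s + m := by omega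
        exact ⟨h, hh, m, by omega, by rw [mul_assoc, stringProd, mul_assoc, hsq, mul_one]⟩
    · exact ⟨h, hh, j + 1, hit, by rw [mul_assoc, stringProd]⟩
    · exact ⟨h * ρ i, mul_mem hh (mem _ (by omega) hit), j, hj, by
        rw [mul_assoc, stringProd_mul_comm hcomm hij hit, mul_assoc]⟩
  induction hg using Subgroup.closure_induction_right with
  | one => exact ⟨1, one_mem _, 0, hst, (one_mul 1).symm⟩
  | mul_right g _ x hx ih =>
    obtain ⟨i, hi, rfl⟩ := hx
    exact step i hi g ih
  | mul_inv_cancel g _ x hx ih =>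
    obtain ⟨i, hi, rfl⟩ := hx
    rw [hinv]
    exact step i hi g ih

lemma exists_stringProd_succ (j : ℕ) (hj : s + (j + 1) ≤ t) :
    ∃ h ∈ Subgroup.closure (ρ '' Set.Ico (s + 1) t), stringProd ρ s (j + 1) = ρ s * h := by
  induction j with
  | zero => exact ⟨1, one_mem _, by simp [stringProd]⟩
  | succ j ih =>
    obtain ⟨h, hh, e⟩ := ih (by omega)
    refine ⟨h * ρ (s + (j + 1)), mul_mem hh (Subgroup.subset_closure ⟨_, ⟨?_, ?_⟩, rfl⟩), ?_⟩
    · omega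
    · omega
    · rw [stringProd, e, mul_assoc]

end Generation

section StringGroups

variable {p : ℕ} [Fact p.Prime] {V : Type*} [AddCommGroup V] [Module (ZMod p) V]
  {B : LinearMap.BilinForm (ZMod p) V} {b : ℕ → V} {n : ℕ}

lemma reflUnit_mul_comm (hs : ∀ x y, B x y = B y x) {a a' : V} (h : B a a' = 0) :
    reflUnit B a * reflUnit B a' = reflUnit B a' * reflUnit B a := by
  have h1 := reflUnit_conj B (reflUnit_isometry B hs a) a'
  have h2 : (reflUnit B a).1 a' = a' := by
    rw [reflUnit_apply, hs, h]; simp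
  rwa [h2, mul_inv_eq_iff_eq_mul] at h1

lemma reflUnit_braid (hs : ∀ x y, B x y = B y x) {a a' : V} (ha : B a a = 1) (ha' : B a' a' = 1)
    (h : 4 * B a a' ^ 2 = 1) :
    reflUnit B a * reflUnit B a' * reflUnit B a = reflUnit B a' * reflUnit B a * reflUnit B a' := by
  have h1 := reflUnit_conj B (reflUnit_isometry B hs a) a'
  have h2 := reflUnit_conj B (reflUnit_isometry B hs a') a
  rw [reflUnit_inv, reflUnit_apply_of_norm ha, hs a' a] at h1
  rw [reflUnit_inv, reflUnit_apply_of_norm ha'] at h2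
  have h0 : -(2 * B a a') ≠ 0 := by
    intro h0
    have : 4 * B a a' ^ 2 = 0 := by linear_combination (-2 * B a a') * h0
    rw [this] at h
    exact zero_ne_one h
  rw [h1, h2, ← reflUnit_smul B h0 (a - _)]
  congr 1
  match_scalars
  · linear_combination -h
  · ring

lemma StringSystem.mem_segGroup_succ (S : StringSystem B b n) (h2 : (2 : ZMod p) ≠ 0) {s t : ℕ}
    (hst : s < t) (ht : t ≤ n)
    (hA : ∀ i, i + 1 < t → 4 * B (b i) (b (i + 1)) ^ 2 = 1) {g : (Module.End (ZMod p) V)ˣ}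
    (hg : g ∈ segGroup B b s t) (hgW : g ∈ trivialMod (icoSpan p b (s + 1) n)) :
    g ∈ segGroup B b (s + 1) t := by
  obtain ⟨h, hh, j, hj, rfl⟩ := exists_eq_mul_stringProd (ρ := fun i ↦ reflUnit B (b i))
    (fun i ↦ reflUnit_mul_self B _)
    (fun i j hij hj ↦ reflUnit_mul_comm S.symm (S.far i j hij (by omega)))
    (fun i hi ↦ reflUnit_braid S.symm (S.norm _ (by omega)) (S.norm _ (by omega)) (hA i hi))
    hst.le hg
  have htriv : ∀ h ∈ segGroup B b (s + 1) t, h ∈ trivialMod (icoSpan p b (s + 1) n) :=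
    fun h hh x ↦ icoSpan_mono le_rfl ht (segGroup_le_trivialMod _ _ hh x)
  cases j with
  | zero =>
    rw [stringProd, mul_one]
    exact hh
  | succ j =>
    obtain ⟨h', hh', e⟩ := exists_stringProd_succ (ρ := fun i ↦ reflUnit B (b i)) j hj
    rw [e] at hgW
    have h3 := (mul_mem_cancel_right (htriv _ hh')).1 ((mul_mem_cancel_left (htriv _ hh)).1 hgW)
    have h4 := h3 (b s)
    rw [reflUnit_apply_of_norm (S.norm s (by omega)), S.norm s (by omega), sub_sub_cancel_left,
      neg_mem_iff, mul_one, Submodule.smul_mem_iff _ h2] at h4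
    have h5 := S.inf_icoSpan (s := s + 1) (t := s + 1) le_rfl (by omega)
      ⟨mem_icoSpan (Nat.zero_le s) (Nat.lt_succ_self s), h4⟩
    rw [icoSpan_eq_bot le_rfl, Submodule.mem_bot] at h5
    have h6 := S.norm s (by omega)
    rw [h5, map_zero] at h6
    exact absurd h6 zero_ne_one

/-- The intersection property for an initial and a final segment. -/
theorem StringSystem.inf_segGroup [Finite V] (S : StringSystem B b n) (hp : p ≠ 2)
    (h2 : (2 : ZMod p) ≠ 0) {s t : ℕ} (hs : s ≤ n) (ht : t ≤ n)
    (hlab : (∀ i, i + 1 < t → 4 * B (b i) (b (i + 1)) ^ 2 = 1) ∨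
      ∃ d, t = d + 2 ∧ B (b d) (b (d + 1)) = -1 ∧ (3 : ZMod p) ≠ 0) :
    segGroup B b 0 t ⊓ segGroup B b s n ≤ segGroup B b s t := by
  rcases Nat.eq_or_lt_of_le ht with rfl | htn
  · exact inf_le_right
  rcases hlab with hA | ⟨d, rfl, hB, h3⟩
  · rintro g ⟨hg, hg'⟩
    have key : ∀ m ≤ s, g ∈ segGroup B b m t := by
      intro m
      induction m with
      | zero => exact fun _ ↦ hg
      | succ m ih =>
        intro hm
        rcases Nat.lt_or_ge m t with h | h
        · exact S.mem_segGroup_succ h2 h ht hA (ih (by omega)) fun x ↦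
            icoSpan_mono hm le_rfl (segGroup_le_trivialMod _ _ hg' x)
        · exact segGroup_le (fun i _ _ ↦ by omega) (ih (by omega))
    exact key s le_rfl
  · rcases Nat.lt_or_ge s (d + 2) with h | h
    · exact S.inf_segGroup_of_neg_one hp h2 h3 (by omega) htn hB
    · rintro g ⟨hg, hg'⟩
      have h1 : g = 1 := units_ext fun x ↦ by
        have h4 := S.inf_icoSpan (s := s) (t := s) le_rfl hs
          ⟨icoSpan_mono le_rfl h (segGroup_le_trivialMod _ _ hg x),
            segGroup_le_trivialMod _ _ hg' x⟩
        rw [icoSpan_eq_bot le_rfl, Submodule.mem_bot, sub_eq_zero] at h4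
        exact h4
      rw [h1]
      exact one_mem _

end StringGroups

section Main

/-- The standard basis, extended by zero to all natural indices. -/
def stdVec (p n : ℕ) (i : ℕ) : Fin n → ZMod p :=
  if h : i < n then Pi.single ⟨i, h⟩ 1 else 0

lemma stdVec_val (p : ℕ) {n : ℕ} (i : Fin n) : stdVec p n i = Pi.single i 1 := by
  rw [stdVec, dif_pos i.2]

lemma toBilin'_gram_apply (p k l m : ℕ) (x y : Fin (k + l + m + 1) → ZMod p) :
    Matrix.toBilin' (gram p k l m) x y = form p k l m x y :=
  Matrix.toBilin'_apply _ _ _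

lemma toBilin'_gram_stdVec (p k l m : ℕ) (i j : Fin (k + l + m + 1)) :
    Matrix.toBilin' (gram p k l m) (stdVec p _ i) (stdVec p _ j) = gram p k l m i j := by
  rw [stdVec_val, stdVec_val, Matrix.toBilin'_single]

lemma gram_comm (p k l m : ℕ) (i j : Fin (k + l + m + 1)) :
    gram p k l m i j = gram p k l m j i := by
  rcases lt_trichotomy i.1 j.1 with h | h | h
  · have h1 : i ≠ j := fun e ↦ by rw [e] at h; exact lt_irrefl _ h
    have h2 : ¬ i.1 = j.1 + 1 := by omega
    simp [gram, h1, h1.symm, h2]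
  · rw [Fin.ext h]
  · have h1 : i ≠ j := fun e ↦ by rw [e] at h; exact lt_irrefl _ h
    have h2 : ¬ j.1 = i.1 + 1 := by omega
    simp [gram, h1, h1.symm, h2]

lemma toBilin'_gram_adj (p k l i : ℕ) (hi : i + 1 < k + l + 0 + 1) :
    Matrix.toBilin' (gram p k l 0) (stdVec p _ i) (stdVec p _ (i + 1)) =
      if i + 1 ≤ k then -(2⁻¹ : ZMod p) else -1 := by
  refine (toBilin'_gram_stdVec p k l 0 ⟨i, by omega⟩ ⟨i + 1, hi⟩).trans ?_
  have h : ¬ k + l + 1 ≤ i + 1 := by omega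
  simp [gram, h]

lemma stringSystem_gram (p k l : ℕ) [Fact p.Prime] (h2 : (2 : ZMod p) ≠ 0) :
    StringSystem (Matrix.toBilin' (gram p k l 0)) (stdVec p (k + l + 0 + 1)) (k + l + 0 + 1) where
  symm x y := by
    rw [Matrix.toBilin'_apply, Matrix.toBilin'_apply, Finset.sum_comm]
    refine Finset.sum_congr rfl fun i _ ↦ Finset.sum_congr rfl fun j _ ↦ ?_
    rw [gram_comm]
    ring
  norm i hi := by
    refine (toBilin'_gram_stdVec p k l 0 ⟨i, hi⟩ ⟨i, hi⟩).trans ?_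
    simp [gram]
  adj i hi := by
    rw [toBilin'_gram_adj p k l i hi]
    split_ifs
    · exact neg_ne_zero.2 (inv_ne_zero h2)
    · exact neg_ne_zero.2 one_ne_zero
  far i j hij hj := by
    refine (toBilin'_gram_stdVec p k l 0 ⟨i, by omega⟩ ⟨j, hj⟩).trans ?_
    have h1 : i ≠ j := by omega
    have h3 : j ≠ i + 1 := by omega
    have h4 : i ≠ j + 1 := by omega
    simp [gram, h1, h3, h4]
  linInd := by
    simp only [stdVec_val]
    exact Pi.linearIndependent_single_one _ _

end Main

/-- for every odd prime `p`, the group `[3^k, ∞^l]ᵖ` is a string C-group. -/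
theorem statement9 (p k l : ℕ) (hp : p.Prime) (hodd : p ≠ 2)
    (r : Fin (k + l + 0 + 1) → GLV p k l 0) (hr : ReflHyp p k l 0 r) :
    IsStringC p k l 0 r := by
  have : Fact p.Prime := ⟨hp⟩
  have h2 : (2 : ZMod p) ≠ 0 := fun h ↦ hodd <| by
    have h3 : p ∣ 2 := (ZMod.natCast_eq_zero_iff 2 p).1 (by exact_mod_cast h)
    exact (Nat.prime_dvd_prime_iff_eq hp Nat.prime_two).1 h3
  have S := stringSystem_gram p k l h2
  set B := Matrix.toBilin' (gram p k l 0) with hB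
  set b := stdVec p (k + l + 0 + 1) with hb
  have hrB : ∀ i : Fin (k + l + 0 + 1), r i = reflUnit B (b i) := fun i ↦ units_ext fun x ↦ by
    rw [hr, reflUnit_apply_of_norm (S.norm i i.2), hb, stdVec_val]
    exact congrArg (fun z ↦ x - (2 * z) • _) (toBilin'_gram_apply p k l 0 x (Pi.single i 1)).symm
  have hlab : ∀ t ≤ k + l + 0 + 1, (∀ i, i + 1 < t → 4 * B (b i) (b (i + 1)) ^ 2 = 1) ∨
      ∃ d, t = d + 2 ∧ B (b d) (b (d + 1)) = -1 ∧ (3 : ZMod p) ≠ 0 := by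
    intro t ht
    have h4 : 4 * (-(2⁻¹ : ZMod p)) ^ 2 = 1 := by
      field_simp
      norm_num
    by_cases h3 : (3 : ZMod p) = 0
    · refine Or.inl fun i hi ↦ ?_
      rw [toBilin'_gram_adj p k l i (by omega)]
      split_ifs
      · exact h4
      · linear_combination h3
    · by_cases htk : t ≤ k + 1
      · refine Or.inl fun i hi ↦ ?_
        rw [toBilin'_gram_adj p k l i (by omega), if_pos (by omega), h4]
      · refine Or.inr ⟨t - 2, by omega, ?_, h3⟩
        rw [toBilin'_gram_adj p k l _ (by omega), if_neg (by omega)]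
  have himg : ∀ I : Set (Fin (k + l + 0 + 1)),
      r '' I = (fun i ↦ reflUnit B (b i)) '' (Fin.val '' I) := fun I ↦ by
    rw [Set.image_image]
    exact Set.image_congr fun i _ ↦ hrB i
  intro I J
  refine le_antisymm ?_ (le_inf (Subgroup.closure_mono (Set.image_mono Set.inter_subset_left))
    (Subgroup.closure_mono (Set.image_mono Set.inter_subset_right)))
  rw [himg, himg, himg, Set.image_inter Fin.val_injective]
  refine closure_inf_closure_le (n := k + l + 0 + 1)
    (fun i j hij hj ↦ reflUnit_mul_comm S.symm (S.far i j hij hj))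
    (fun s t hs ht ↦ S.inf_segGroup hodd h2 hs ht (hlab t ht)) ?_ ?_
  · rintro _ ⟨i, -, rfl⟩
    exact i.2
  · rintro _ ⟨i, -, rfl⟩
    exact i.2

end Statement9
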